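/- arXiv:1609.01950 — 3 statements merged into one kernel-verified Lean document; each statement's English description precedes it below -/
import Mathlib

section
/- Let a ∈ W_s(K). Then: (i) ord_K(F(a)) = p·ord_K(a); (ii) if ord_K(a) < 0 then ord_K(F(a) − a) = p·ord_K(a), while if ord_K(a) ≥ 0 then ord_K(F(a) − a) ≥ 0; (iii) for every integer n ≥ 0, the preimages F^{-1}(fil_n W_s(K)) and (F−1)^{-1}(fil_n W_s(K)) both equal fil_{[n/p]} W_s(K). -/
/-!
Setting: `K` is a (complete) discrete valuation field of characteristic `p > 0`, with
normalized additive valuation `v = ord_K : K → ℤ ∪ {∞}` (normalization is expressed by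
the existence of a uniformizer `π` with `v π = 1`).

`W_s(K)` is the ring of `p`-typical Witt vectors of length `s` over `K`.  Following the
paper, a Witt vector is written `a = (a_{s-1}, …, a_0)`, where the paper's component
`a_i` is the component of standard index `s - 1 - i` (so `a_{s-1}` is the leading
component and the Verschiebung `V` sends `(a_{s-1}, …, a_0)` to `(0, a_{s-1}, …, a_0)`,
i.e. it is the standard index shift).  We realize `W_s(K)` as `TruncatedWittVector p s K`.
-/

noncomputable section

open TruncatedWittVector

variable (p : ℕ) [Fact p.Prime] (K : Type*) [Field K] [CharP K p]
variable (v : AddValuation K (WithTop ℤ))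

/-- The Frobenius `F : W_s(K) → W_s(K)`, raising each component to the `p`-th power. -/
def frobW {s : ℕ} (a : TruncatedWittVector p s K) : TruncatedWittVector p s K :=
  TruncatedWittVector.mk p fun i => a.coeff i ^ p

/-- The `k`-fold Verschiebung `V^k : W_t(K) → W_s(K)` (for `t + k = s`), shifting
components: in the paper's notation it sends `(a_{t-1}, …, a_0)` to
`(0, …, 0, a_{t-1}, …, a_0)`. -/
def VShift (k : ℕ) {t : ℕ} (s : ℕ) (a : TruncatedWittVector p t K) :
    TruncatedWittVector p s K :=
  TruncatedWittVector.mk p fun i =>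
    if h : k ≤ (i : ℕ) ∧ (i : ℕ) - k < t then a.coeff ⟨(i : ℕ) - k, h.2⟩ else 0

/-- The truncation `pr_t : W_s(K) → W_t(K)`, `(a_{s-1}, …, a_0) ↦ (a_{s-1}, …, a_{s-t})`. -/
def prW {s : ℕ} (t : ℕ) (ht : t ≤ s) (a : TruncatedWittVector p s K) :
    TruncatedWittVector p t K :=
  TruncatedWittVector.mk p fun i => a.coeff (Fin.castLE ht i)

/-- `ord_K(a) = min_{0 ≤ i ≤ s-1} p^i · ord_K(a_i)` for a Witt vector
`a = (a_{s-1}, …, a_0) ∈ W_s(K)` (the paper's component `a_i` has standard index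
`s - 1 - i`, whence the weight `p ^ (s - 1 - i)` below). -/
def wittOrd {s : ℕ} (a : TruncatedWittVector p s K) : WithTop ℤ :=
  Finset.univ.inf fun i : Fin s => p ^ (s - 1 - (i : ℕ)) • v (a.coeff i)

/-- Brylinski--Kato filtration `fil_n W_s(K) = {a ∈ W_s(K) | ord_K(a) ≥ -n}`. -/
def filW (s : ℕ) (n : ℤ) : Set (TruncatedWittVector p s K) :=
  {a | ((-n : ℤ) : WithTop ℤ) ≤ wittOrd p K v a}

/-- `fil^{(r)}_n W_s(K) = fil_{[n/p^r]} W_s(K)` (for `n ≥ 0`). -/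
def filWr (s r : ℕ) (n : ℕ) : Set (TruncatedWittVector p s K) :=
  filW p K v s ((n / p ^ r : ℕ) : ℤ)

/-- Matsuda's filtration
`fil'_m W_s(K) = fil_{m-1} W_s(K) + V^{s-s'}(fil_m W_{s'}(K))`, `s' = min(ord_p m, s)`. -/
def filW' (s m : ℕ) : Set (TruncatedWittVector p s K) :=
  {a | ∃ b ∈ filW p K v s ((m : ℤ) - 1),
      ∃ c ∈ filW p K v (min (padicValNat p m) s) (m : ℤ),
        a = b + VShift p K (s - min (padicValNat p m) s) s c}

/-- `fil'^{(r)}_m W_s(K) = fil^{(r)}_{m-1} W_s(K) + V^{s-s''}(fil^{(r)}_m W_{s''}(K))`,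
where `s'' = max(0, min(ord_p m, s + r) - r)`. -/
def filW'r (s r m : ℕ) : Set (TruncatedWittVector p s K) :=
  {a | ∃ b ∈ filWr p K v s r (m - 1),
      ∃ c ∈ filWr p K v (min (padicValNat p m) (s + r) - r) r m,
        a = b + VShift p K (s - (min (padicValNat p m) (s + r) - r)) s c}

/-- `fil''^{(r)}_m W_s(K) = fil^{(r)}_{[(m-1)/p]} W_s(K) + V^{s-s''}(fil^{(r)}_{[m/p]} W_{s''}(K))`,
where `s'' = max(0, min(ord_p m, s + r) - r)`. -/
def filW''r (s r m : ℕ) : Set (TruncatedWittVector p s K) :=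
  {a | ∃ b ∈ filWr p K v s r ((m - 1) / p),
      ∃ c ∈ filWr p K v (min (padicValNat p m) (s + r) - r) r (m / p),
        a = b + VShift p K (s - (min (padicValNat p m) (s + r) - r)) s c}

/-- `fil''_m W_s(K) = fil''^{(0)}_m W_s(K)
  = fil_{[(m-1)/p]} W_s(K) + V^{s-s'}(fil_{[m/p]} W_{s'}(K))`. -/
def filW'' (s m : ℕ) : Set (TruncatedWittVector p s K) :=
  filW''r p K v s 0 m

theorem WittVector.frobenius_teichmuller_charP {p : ℕ} [Fact p.Prime] {R : Type*} [CommRing R]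
    [CharP R p] (c : R) :
    WittVector.frobenius (WittVector.teichmuller p c) = WittVector.teichmuller p (c ^ p) := by
  ext n
  rw [WittVector.coeff_frobenius_charP]
  cases n with
  | zero => rw [WittVector.teichmuller_coeff_zero, WittVector.teichmuller_coeff_zero]
  | succ n =>
    rw [WittVector.teichmuller_coeff_pos _ _ _ n.succ_pos,
      WittVector.teichmuller_coeff_pos _ _ _ n.succ_pos, zero_pow (Fact.out : p.Prime).ne_zero]

theorem WittVector.teichmuller_add_verschiebung_coeff {p : ℕ} [Fact p.Prime] {R : Type*}
    [CommRing R] (c : R) (y : WittVector p R) (n : ℕ) :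
    (WittVector.teichmuller p c + WittVector.verschiebung y).coeff n =
      (WittVector.teichmuller p c).coeff n + (WittVector.verschiebung y).coeff n := by
  apply WittVector.coeff_add_of_disjoint
  intro n
  cases n with
  | zero => exact Or.inr (WittVector.verschiebung_coeff_zero y)
  | succ n => exact Or.inl (WittVector.teichmuller_coeff_pos p c (n + 1) n.succ_pos)

/-- Multiplication by a Teichmüller representative scales the coefficients. -/
theorem WittVector.teichmuller_mul_coeff_charP {p : ℕ} [Fact p.Prime] {R : Type*} [CommRing R]
    [CharP R p] (c : R) (x : WittVector p R) (n : ℕ) :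
    (WittVector.teichmuller p c * x).coeff n = c ^ p ^ n * x.coeff n := by
  induction n generalizing c x with
  | zero => simp [WittVector.mul_coeff_zero]
  | succ n ih =>
    have hx : x = WittVector.teichmuller p (x.coeff 0) +
        WittVector.verschiebung (x.shift 1) := by
      ext k
      rw [WittVector.teichmuller_add_verschiebung_coeff]
      cases k with
      | zero => simp
      | succ k => simp [WittVector.verschiebung_coeff_succ, WittVector.shift_coeff, add_comm]
    have h : WittVector.teichmuller p c * x = WittVector.teichmuller p (c * x.coeff 0) +
        WittVector.verschiebung (WittVector.teichmuller p (c ^ p) * x.shift 1) := by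
      conv_lhs => rw [hx]
      rw [mul_add, ← map_mul, mul_comm _ (WittVector.verschiebung _),
        ← WittVector.verschiebung_mul_frobenius, WittVector.frobenius_teichmuller_charP,
        mul_comm (x.shift 1)]
    rw [h, WittVector.teichmuller_add_verschiebung_coeff, WittVector.verschiebung_coeff_succ, ih,
      WittVector.teichmuller_coeff_pos p _ _ n.succ_pos, zero_add, WittVector.shift_coeff,
      ← pow_mul, ← pow_succ', add_comm 1 n]

section

variable {p K}

/-- The ring of integers of an additive valuation. -/
def AddValuation.integerSubring {F : Type*} [Field F] (w : AddValuation F (WithTop ℤ)) :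
    Subring F where
  carrier := {x | 0 ≤ w x}
  mul_mem' hx hy := by
    simp only [Set.mem_ofPred_eq] at *
    rw [w.map_mul]
    exact add_nonneg hx hy
  one_mem' := by simp
  add_mem' hx hy := w.map_le_add hx hy
  zero_mem' := by simp
  neg_mem' hx := by simpa using hx

theorem AddValuation.exists_eq_intCast {F : Type*} [Field F] (w : AddValuation F (WithTop ℤ))
    (hw : ∃ π : F, w π = 1) (m : ℤ) : ∃ c : F, w c = (m : WithTop ℤ) := by
  obtain ⟨π, hπ⟩ := hw
  have hpow : ∀ n : ℕ, w (π ^ n) = ((n : ℤ) : WithTop ℤ) := by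
    intro n
    rw [w.map_pow, hπ]
    simp
  obtain ⟨n, rfl | rfl⟩ := m.eq_nat_or_neg
  · exact ⟨π ^ n, hpow n⟩
  · refine ⟨(π ^ n)⁻¹, ?_⟩
    have hne : π ^ n ≠ 0 := by
      intro h
      have := hpow n
      rw [h, w.map_zero] at this
      exact WithTop.coe_ne_top this.symm
    have h := w.map_mul (π ^ n) (π ^ n)⁻¹
    rw [mul_inv_cancel₀ hne, w.map_one, hpow] at h
    generalize w (π ^ n)⁻¹ = t at h ⊢
    cases t with
    | top => simp at h
    | coe t =>
      norm_cast at h ⊢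
      omega

theorem WithTop.nsmul_top_int {k : ℕ} (hk : 0 < k) : k • (⊤ : WithTop ℤ) = ⊤ := by
  obtain ⟨k, rfl⟩ := Nat.exists_eq_succ_of_ne_zero hk.ne'
  rw [Nat.succ_eq_add_one, succ_nsmul, WithTop.add_top]

theorem WithTop.nsmul_le_nsmul_add_iff (r : WithTop ℤ) (m : ℤ) (k : ℕ) :
    k • (m : WithTop ℤ) ≤ k • (m : WithTop ℤ) + r ↔ 0 ≤ r := by
  rw [← WithTop.coe_nsmul]
  cases r with
  | top => simp
  | coe r =>
    norm_cast
    simp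

/-- A Witt vector over `K` lies in `[c] · W(𝒪_K)` as soon as its `n`-th coefficient has valuation
at least `p ^ n * v c`. -/
theorem exists_eq_teichmuller_mul_map {c : K} {m : ℤ} (hc : v c = (m : WithTop ℤ))
    (x : WittVector p K) :
    (∀ n, p ^ n • (m : WithTop ℤ) ≤ v (x.coeff n)) ↔
      ∃ y : WittVector p v.integerSubring,
        x = WittVector.teichmuller p c * WittVector.map v.integerSubring.subtype y := by
  have hne : c ≠ 0 := by
    rintro rfl
    rw [v.map_zero] at hc
    exact WithTop.coe_ne_top hc.symm
  have key : ∀ (n : ℕ) (r : K), p ^ n • (m : WithTop ℤ) ≤ v (c ^ p ^ n * r) ↔ 0 ≤ v r := by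
    intro n r
    rw [v.map_mul, v.map_pow, hc, WithTop.nsmul_le_nsmul_add_iff]
  constructor
  · intro h
    refine ⟨WittVector.mk p fun n => ⟨(c ^ p ^ n)⁻¹ * x.coeff n, ?_⟩, ?_⟩
    · refine (key n _).1 ?_
      rw [mul_inv_cancel_left₀ (pow_ne_zero _ hne)]
      exact h n
    · ext n
      rw [WittVector.teichmuller_mul_coeff_charP, WittVector.map_coeff]
      exact (mul_inv_cancel_left₀ (pow_ne_zero _ hne) _).symm
  · rintro ⟨y, rfl⟩ n
    rw [WittVector.teichmuller_mul_coeff_charP, key]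
    exact (y.coeff n).2

theorem le_valuation_sub_coeff (hv : ∃ π : K, v π = 1) {m : ℤ} {x y : WittVector p K}
    (hx : ∀ n, p ^ n • (m : WithTop ℤ) ≤ v (x.coeff n))
    (hy : ∀ n, p ^ n • (m : WithTop ℤ) ≤ v (y.coeff n)) (n : ℕ) :
    p ^ n • (m : WithTop ℤ) ≤ v ((x - y).coeff n) := by
  obtain ⟨c, hc⟩ := v.exists_eq_intCast hv m
  obtain ⟨x', hx'⟩ := (exists_eq_teichmuller_mul_map v hc x).1 hx
  obtain ⟨y', hy'⟩ := (exists_eq_teichmuller_mul_map v hc y).1 hy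
  refine (exists_eq_teichmuller_mul_map v hc (x - y)).2 ⟨x' - y', ?_⟩ n
  rw [hx', hy', map_sub, mul_sub]

theorem WithTop.le_pow_nsmul_iff {q s i : ℕ} (hq : 0 < q) (hi : i < s) (m : ℤ) (t : WithTop ℤ) :
    (m : WithTop ℤ) ≤ q ^ (s - 1 - i) • t ↔ q ^ i • (m : WithTop ℤ) ≤ q ^ (s - 1) • t := by
  have hs : s - 1 = i + (s - 1 - i) := by omega
  generalize s - 1 - i = j at hs ⊢
  rw [hs, pow_add, mul_nsmul']
  cases t with
  | top =>
    simp only [WithTop.nsmul_top_int (pow_pos hq _), le_top]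
  | coe t =>
    norm_cast
    simp only [nsmul_eq_mul]
    exact (mul_le_mul_iff_right₀ (by positivity)).symm

theorem le_wittOrd_iff {s : ℕ} (m : ℤ) (a : TruncatedWittVector p s K) :
    (m : WithTop ℤ) ≤ wittOrd p K v a ↔
      ∀ n, p ^ n • (m : WithTop ℤ) ≤
        v ((WittVector.frobenius^[s - 1] a.out).coeff n) := by
  have hp := (Fact.out : p.Prime).pos
  simp only [wittOrd, Finset.le_inf_iff, Finset.mem_univ, true_imp_iff,
    WittVector.iterate_frobenius_coeff, v.map_pow]
  constructor
  · intro h n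
    by_cases hn : n < s
    · have := (WithTop.le_pow_nsmul_iff hp hn m _).1 (h ⟨n, hn⟩)
      rwa [← TruncatedWittVector.coeff_out] at this
    · simp [TruncatedWittVector.out, hn, WithTop.nsmul_top_int (pow_pos hp _)]
  · intro h i
    rw [WithTop.le_pow_nsmul_iff hp i.2, ← TruncatedWittVector.coeff_out]
    exact h i

theorem le_wittOrd_sub (hv : ∃ π : K, v π = 1) {s : ℕ} {m : ℤ} {a b : TruncatedWittVector p s K}
    (ha : (m : WithTop ℤ) ≤ wittOrd p K v a) (hb : (m : WithTop ℤ) ≤ wittOrd p K v b) :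
    (m : WithTop ℤ) ≤ wittOrd p K v (a - b) := by
  have hp := (Fact.out : p.Prime).pos
  rw [le_wittOrd_iff] at ha hb
  simp only [wittOrd, Finset.le_inf_iff, Finset.mem_univ, true_imp_iff]
  intro i
  have h := le_valuation_sub_coeff v hv ha hb i
  rw [← iterate_map_sub, WittVector.iterate_frobenius_coeff, v.map_pow,
    ← WittVector.coeff_truncateFun, WittVector.truncateFun_sub,
    TruncatedWittVector.truncateFun_out, TruncatedWittVector.truncateFun_out] at h
  exact (WithTop.le_pow_nsmul_iff hp i.2 m _).2 h

theorem le_wittOrd_add (hv : ∃ π : K, v π = 1) {s : ℕ} {m : ℤ} {a b : TruncatedWittVector p s K}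
    (ha : (m : WithTop ℤ) ≤ wittOrd p K v a) (hb : (m : WithTop ℤ) ≤ wittOrd p K v b) :
    (m : WithTop ℤ) ≤ wittOrd p K v (a + b) := by
  have h0 : (m : WithTop ℤ) ≤ wittOrd p K v (b - b) := le_wittOrd_sub v hv hb hb
  have h := le_wittOrd_sub v hv ha (le_wittOrd_sub v hv h0 hb)
  rwa [sub_self, zero_sub, sub_neg_eq_add] at h

theorem wittOrd_frobW {s : ℕ} (a : TruncatedWittVector p s K) :
    wittOrd p K v (frobW p K a) = p • wittOrd p K v a := by
  have hp := (Fact.out : p.Prime).pos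
  rw [wittOrd, wittOrd, Finset.apply_inf_eq_inf_comp_of_linearOrder (fun t : WithTop ℤ => p • t)
    (fun x y h => nsmul_le_nsmul_right h p) (WithTop.nsmul_top_int hp)]
  refine Finset.inf_congr rfl fun i _ => ?_
  simp only [Function.comp_apply, frobW, TruncatedWittVector.coeff_mk, v.map_pow]
  rw [smul_comm]

theorem wittOrd_frobW_sub_of_neg (hv : ∃ π : K, v π = 1) {s : ℕ} (a : TruncatedWittVector p s K)
    (ha : wittOrd p K v a < 0) : wittOrd p K v (frobW p K a - a) = p • wittOrd p K v a := by
  have hp := (Fact.out : p.Prime).two_le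
  obtain ⟨n, hn⟩ := WithTop.ne_top_iff_exists.1 ha.ne_top
  have hF := wittOrd_frobW v a
  rw [← hn] at ha hF ⊢
  rw [← WithTop.coe_nsmul] at hF ⊢
  have hn0 : n < 0 := by exact_mod_cast ha
  have hlt : p • n < n := by
    rw [nsmul_eq_mul]
    nlinarith
  refine le_antisymm ?_ (le_wittOrd_sub v hv hF.ge ?_)
  · by_contra! hcon
    have h1 : ((p • n + 1 : ℤ) : WithTop ℤ) ≤ wittOrd p K v (frobW p K a - a) := by
      generalize wittOrd p K v (frobW p K a - a) = t at hcon ⊢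
      cases t with
      | top => exact le_top
      | coe t => exact WithTop.coe_le_coe.2 (Int.add_one_le_of_lt (WithTop.coe_lt_coe.1 hcon))
    have h2 : ((p • n + 1 : ℤ) : WithTop ℤ) ≤ wittOrd p K v a := by
      rw [← hn]
      exact WithTop.coe_le_coe.2 hlt
    have h3 := le_wittOrd_add v hv h1 h2
    rw [sub_add_cancel, hF, WithTop.coe_le_coe] at h3
    omega
  · rw [← hn]
    exact WithTop.coe_le_coe.2 hlt.le

theorem WithTop.neg_le_nsmul_iff {q : ℕ} (hq : 0 < q) (n : ℕ) (t : WithTop ℤ) :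
    ((-(n : ℤ) : ℤ) : WithTop ℤ) ≤ q • t ↔ ((-((n / q : ℕ) : ℤ) : ℤ) : WithTop ℤ) ≤ t := by
  cases t with
  | top => simp only [WithTop.nsmul_top_int hq, le_top]
  | coe t =>
    rw [← WithTop.coe_nsmul, WithTop.coe_le_coe, WithTop.coe_le_coe, nsmul_eq_mul, Int.natCast_div,
      neg_le, neg_le (b := t), Int.le_ediv_iff_mul_le (by exact_mod_cast hq)]
    constructor <;> intro h <;> linarith

end

/-- Lemma 1.6 of the paper.  For `a ∈ W_s(K)`:
(i) `ord_K(F a) = p · ord_K a`;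
(ii) if `ord_K a < 0` then `ord_K(F a - a) = p · ord_K a`, and if `ord_K a ≥ 0` then
`ord_K(F a - a) ≥ 0`;
(iii) for every integer `n ≥ 0`, `F⁻¹(fil_n W_s(K)) = (F-1)⁻¹(fil_n W_s(K))
  = fil_{[n/p]} W_s(K)`. -/
theorem statement0 (hv : ∃ π : K, v π = 1) (s : ℕ) :
    (∀ a : TruncatedWittVector p s K,
        wittOrd p K v (frobW p K a) = p • wittOrd p K v a) ∧
    (∀ a : TruncatedWittVector p s K,
        (wittOrd p K v a < 0 →
          wittOrd p K v (frobW p K a - a) = p • wittOrd p K v a) ∧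
        (0 ≤ wittOrd p K v a → 0 ≤ wittOrd p K v (frobW p K a - a))) ∧
    (∀ n : ℕ,
        (fun a : TruncatedWittVector p s K => frobW p K a) ⁻¹' (filW p K v s (n : ℤ))
            = filW p K v s ((n / p : ℕ) : ℤ) ∧
        (fun a : TruncatedWittVector p s K => frobW p K a - a) ⁻¹' (filW p K v s (n : ℤ))
            = filW p K v s ((n / p : ℕ) : ℤ)) := by
  have hp := (Fact.out : p.Prime).pos
  have hnonneg : ∀ a : TruncatedWittVector p s K, 0 ≤ wittOrd p K v a →
      0 ≤ wittOrd p K v (frobW p K a - a) := fun a ha => by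
    refine le_wittOrd_sub v hv (m := 0) ?_ ha
    rw [wittOrd_frobW]
    exact nsmul_nonneg ha p
  refine ⟨wittOrd_frobW v, fun a => ⟨wittOrd_frobW_sub_of_neg v hv a, hnonneg a⟩, fun n => ⟨?_, ?_⟩⟩
  · ext a
    simp only [Set.mem_preimage, filW, Set.mem_ofPred_eq, wittOrd_frobW]
    exact WithTop.neg_le_nsmul_iff hp n _
  · ext a
    simp only [Set.mem_preimage, filW, Set.mem_ofPred_eq]
    rcases lt_or_ge (wittOrd p K v a) 0 with ha | ha
    · rw [wittOrd_frobW_sub_of_neg v hv a ha]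
      exact WithTop.neg_le_nsmul_iff hp n _
    · have hneg : ∀ k : ℕ, ((-(k : ℤ) : ℤ) : WithTop ℤ) ≤ 0 := fun k =>
        WithTop.coe_le_coe.2 (by simp)
      exact iff_of_true ((hneg n).trans (hnonneg a ha)) ((hneg _).trans ha)
end
end

section
/- Let n ≥ 1 be an integer. Then: (a) if x ∈ fil_{[n/p]} W_s(K) and F(x) ∈ fil_{n-1} W_s(K), then x ∈ fil_{[(n-1)/p]} W_s(K) (so F induces an injection fil_{[n/p]}W_s(K)/fil_{[(n-1)/p]}W_s(K) → fil_nW_s(K)/fil_{n-1}W_s(K)); (b) for a = (a_{s-1},…,a_0) ∈ fil_n W_s(K), one has Σ_{i=0}^{s-1} a_i^{p^i−1} da_i ∈ fil_{n-1} Ω¹_K if and only if a ∈ fil_{n-1} W_s(K) + F(fil_{[n/p]} W_s(K)). In other words, the sequence 0 → fil_{[n/p]}W_s(K)/fil_{[(n-1)/p]}W_s(K) → fil_nW_s(K)/fil_{n-1}W_s(K) → fil_nΩ¹_K/fil_{n-1}Ω¹_K, with first map induced by F and second map induced by a ↦ −Σ a_i^{p^i−1}da_i, is exact. -/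
/-!
Setting: `K` is a (complete) discrete valuation field of characteristic `p > 0`, with
normalized additive valuation `v = ord_K : K → ℤ ∪ {∞}` (normalization is expressed by
the existence of a uniformizer `π` with `v π = 1`).

`W_s(K)` is the ring of `p`-typical Witt vectors of length `s` over `K`.  Following the
paper, a Witt vector is written `a = (a_{s-1}, …, a_0)`, where the paper's component
`a_i` is the component of standard index `s - 1 - i` (so `a_{s-1}` is the leading
component and the Verschiebung `V` sends `(a_{s-1}, …, a_0)` to `(0, a_{s-1}, …, a_0)`,
i.e. it is the standard index shift).  We realize `W_s(K)` as `TruncatedWittVector p s K`.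
-/

noncomputable section

open TruncatedWittVector

variable (p : ℕ) [Fact p.Prime] (K : Type*) [Field K] [CharP K p]
variable (v : AddValuation K (WithTop ℤ))

/-- The subfield `K^p ⊆ K` of `p`-th powers of `K`. -/
def Kp : Subfield K := Subfield.closure {x : K | ∃ y : K, y ^ p = x}

/-- The sum `∑_{i=0}^{s-1} a_i^{p^i - 1} d a_i ∈ Ω¹_K` attached to a Witt vector
`a = (a_{s-1}, …, a_0) ∈ W_s(K)` (the map `-F^{s-1} d` of the paper is its negative).
Here `Ω¹_K` is the module of Kähler differentials of `K` over its subfield `K^p`,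
with universal derivation `d`. -/
def sumForm {s : ℕ} (a : TruncatedWittVector p s K) : KaehlerDifferential (Kp p K) K :=
  ∑ i : Fin s, (a.coeff i ^ (p ^ (s - 1 - (i : ℕ)) - 1)) •
    KaehlerDifferential.D (Kp p K) K (a.coeff i)

/-- The logarithmic filtration
`fil_n Ω¹_K = 𝔪^{-n} Ω¹_{𝒪_K}(log)`: the `𝒪_K`-submodule of `Ω¹_K` generated by
`π^{-n-1} dπ` together with `{π^{-n} da : a ∈ 𝒪_K}`, for a uniformizer `π`. -/
def filOmegaLog (π : K) (n : ℤ) : AddSubgroup (KaehlerDifferential (Kp p K) K) :=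
  AddSubgroup.closure
    {ω | ∃ c a : K, 0 ≤ v c ∧ 0 ≤ v a ∧
        (ω = (c * π ^ (-n - 1)) • KaehlerDifferential.D (Kp p K) K π ∨
         ω = (c * π ^ (-n)) • KaehlerDifferential.D (Kp p K) K a)}

theorem Derivation.map_pow_char_mul {p : ℕ} {R : Type*} [CommRing R] [CharP R p]
    (D : Derivation ℤ R R)
    (y z : R) : D (y ^ p * z) = y ^ p * D z := by
  rw [D.leibniz, D.leibniz_pow]
  simp

section PthRoots

variable {p : ℕ} [Fact p.Prime] {F : Type*} [Field F] [CharP F p]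

open Polynomial

/-- An element outside a subfield containing all `p`-th powers has minimal polynomial
`X ^ p - w ^ p` over it. -/
theorem irreducible_X_pow_sub_C_of_notMem (E : Subfield F) (hE : ∀ x : F, x ^ p ∈ E)
    {w : F} (hw : w ∉ E) :
    Irreducible (X ^ p - C (⟨w ^ p, hE w⟩ : E) : E[X]) := by
  refine X_pow_sub_C_irreducible_of_prime Fact.out fun b hb => hw ?_
  have h : (b : F) ^ p = w ^ p := by simpa using congrArg Subtype.val hb
  rw [← frobenius_inj F p h]
  exact b.2

theorem X_pow_sub_C_dvd_of_aeval_eq_zero (E : Subfield F) (hE : ∀ x : F, x ^ p ∈ E)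
    {w : F} (hw : w ∉ E) {P : E[X]} (hP : aeval w P = 0) :
    (X ^ p - C (⟨w ^ p, hE w⟩ : E) : E[X]) ∣ P := by
  have h := minpoly.eq_of_irreducible_of_monic (irreducible_X_pow_sub_C_of_notMem E hE hw)
    (x := w) (by simp [sub_eq_zero]; rfl) (monic_X_pow_sub_C _ (Fact.out : p.Prime).ne_zero)
  rw [h]
  exact minpoly.dvd E w hP

theorem eq_zero_of_aeval_eq_zero_of_degree_lt (E : Subfield F) (hE : ∀ x : F, x ^ p ∈ E)
    {w : F} (hw : w ∉ E) {P : E[X]} (hP : aeval w P = 0) (hd : P.degree < p) : P = 0 := by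
  refine eq_zero_of_dvd_of_degree_lt (X_pow_sub_C_dvd_of_aeval_eq_zero E hE hw hP) ?_
  rwa [degree_X_pow_sub_C (Fact.out : p.Prime).pos]

/-- A maximal subfield containing the `p`-th powers but not `w` is a complement of `w`. -/
theorem exists_subfield_aeval_surjective {w : F} (hw : ∀ y : F, y ^ p ≠ w) :
    ∃ E : Subfield F, (∀ x : F, x ^ p ∈ E) ∧ w ∉ E ∧
      Function.Surjective (aeval w : E[X] → F) := by
  obtain ⟨E, hE₀, hmax⟩ := zorn_le_nonempty₀
    {E : Subfield F | (∀ x : F, x ^ p ∈ E) ∧ w ∉ E} (fun c hc hchain E₀ hE₀ => by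
      refine ⟨sSup c, ⟨fun x => ?_, fun hmem => ?_⟩, fun z hz => le_sSup hz⟩
      · exact le_sSup hE₀ ((hc hE₀).1 x)
      · rw [Subfield.mem_sSup_of_directedOn ⟨E₀, hE₀⟩ hchain.directedOn] at hmem
        obtain ⟨s, hs, hws⟩ := hmem
        exact (hc hs).2 hws) (frobenius F p).fieldRange
    ⟨fun x => ⟨x, rfl⟩, fun ⟨y, hy⟩ => hw y hy⟩
  obtain ⟨hE, hwE⟩ := hmax.prop
  refine ⟨E, hE, hwE, fun x => ?_⟩
  have h_int : ∀ y : F, IsIntegral E y := fun y =>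
    ⟨X ^ p - C (⟨y ^ p, hE y⟩ : E), monic_X_pow_sub_C _ (Fact.out : p.Prime).ne_zero, by
      simp [sub_eq_zero]; rfl⟩
  have hfin : ∀ y : F, y ∉ E → Module.finrank E (IntermediateField.adjoin E {y}) = p := by
    intro y hy
    rw [IntermediateField.adjoin.finrank (h_int y), ← minpoly.eq_of_irreducible_of_monic
      (irreducible_X_pow_sub_C_of_notMem E hE hy) (x := y) (by simp [sub_eq_zero]; rfl)
      (monic_X_pow_sub_C _ (Fact.out : p.Prime).ne_zero)]
    exact natDegree_X_pow_sub_C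
  have hx : x ∈ IntermediateField.adjoin E {w} := by
    by_cases hxE : x ∈ E
    · exact (IntermediateField.adjoin E {w}).algebraMap_mem ⟨x, hxE⟩
    have hwx : w ∈ IntermediateField.adjoin E {x} := by
      by_contra hcon
      have hle : E ≤ (IntermediateField.adjoin E {x}).toSubfield := fun y hy =>
        (IntermediateField.adjoin E {x}).algebraMap_mem ⟨y, hy⟩
      have := hmax.le_of_ge (y := (IntermediateField.adjoin E {x}).toSubfield)
        ⟨fun y => hle (hE y), hcon⟩ hle
      exact hxE (this (IntermediateField.mem_adjoin_simple_self E x))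
    have : FiniteDimensional E (IntermediateField.adjoin E {x}) :=
      IntermediateField.adjoin.finiteDimensional (h_int x)
    have heq := IntermediateField.eq_of_le_of_finrank_eq
      (IntermediateField.adjoin_simple_le_iff.mpr hwx) ((hfin w hwE).trans (hfin x hxE).symm)
    rw [heq]
    exact IntermediateField.mem_adjoin_simple_self E x
  rw [← IntermediateField.mem_toSubalgebra,
    IntermediateField.adjoin_simple_toSubalgebra_of_isAlgebraic (h_int w).isAlgebraic,
    Algebra.adjoin_singleton_eq_range_aeval] at hx
  exact hx

/-- `z ↦ z ^ (p - 1) * D z` is additive modulo the image of `D`. -/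
theorem exists_derivation_add_pow_sub_one_mul (D : Derivation ℤ F F) (x y : F) :
    ∃ h : F, (x + y) ^ (p - 1) * D (x + y) =
      x ^ (p - 1) * D x + y ^ (p - 1) * D y + D h := by
  have hp1 : p - 1 + 1 = p := Nat.sub_add_cancel (Fact.out : p.Prime).one_le
  rcases eq_or_ne y 0 with rfl | hy
  · refine ⟨0, ?_⟩
    simp
  obtain ⟨r, hr⟩ := exists_add_pow_prime_eq (Fact.out : p.Prime) (X : ℤ[X]) 1
  have hder : (X + 1 : ℤ[X]) ^ (p - 1) = X ^ (p - 1) + derivative (X * r) := by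
    have h := congrArg derivative hr
    simp only [derivative_pow, derivative_add, derivative_X, derivative_one, one_pow, mul_one,
      add_zero, mul_assoc, derivative_natCast_mul] at h
    have hp0 : (p : ℤ[X]) ≠ 0 := by exact_mod_cast (Fact.out : p.Prime).ne_zero
    refine mul_left_cancel₀ hp0 ?_
    simpa [mul_add] using h
  obtain ⟨u, rfl⟩ : ∃ u, x = y * u := ⟨x / y, by field_simp⟩
  refine ⟨y ^ p * aeval u (X * r), ?_⟩
  have hu := congrArg (aeval u) hder
  simp only [map_pow, map_add, map_one, aeval_X] at hu
  rw [Derivation.map_pow_char_mul, D.map_aeval, show y * u + y = y * (u + 1) by ring, D.leibniz,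
    D.leibniz, map_add, D.map_one_eq_zero, eq_sub_of_add_eq' hu.symm]
  simp only [smul_eq_mul, mul_pow]
  have h1 : (u + 1) ^ p = u ^ p + 1 := by rw [add_pow_char, one_pow]
  rw [← hp1] at h1 ⊢
  simp only [pow_succ, Nat.add_sub_cancel] at h1 ⊢
  linear_combination (y ^ (p - 1) * D y) * h1

/-- A non-`p`-th power `w` admits a derivation with `D w = w` whose image meets the
`p`-th powers trivially, and for which `y ^ (p - 1) * D y` is a `p`-th power modulo the image. -/
theorem exists_derivation_eq_self {w : F} (hw : ∀ y : F, y ^ p ≠ w) :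
    ∃ D : Derivation ℤ F F, D w = w ∧ (∀ y z : F, D y = z ^ p → z = 0) ∧
      ∀ y : F, ∃ z : F, y ^ (p - 1) * D y - D y ^ p = D z := by
  obtain ⟨E, hE, hwE, hsurj⟩ := exists_subfield_aeval_surjective hw
  have hp : (p : E[X]) = 0 := by
    have : CharP E p := inferInstance
    exact CharP.cast_eq_zero _ _
  have key : ∀ P : E[X], aeval w P = 0 → aeval w (derivative P) = 0 := by
    intro P hP
    obtain ⟨Q, rfl⟩ := X_pow_sub_C_dvd_of_aeval_eq_zero E hE hwE hP
    have h0 : aeval w (X ^ p - C (⟨w ^ p, hE w⟩ : E) : E[X]) = 0 := by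
      simp [sub_eq_zero]; rfl
    rw [derivative_mul, map_add, map_mul, map_mul, h0]
    simp [derivative_X_pow]
  have key' : ∀ P Q : E[X], aeval w P = aeval w Q →
      w * aeval w (derivative P) = w * aeval w (derivative Q) := by
    intro P Q h
    have := key (P - Q) (by simp [h])
    rw [derivative_sub, map_sub, sub_eq_zero] at this
    rw [this]
  choose r hr using hsurj
  let D : Derivation ℤ F F := Derivation.mk'
    (AddMonoidHom.toIntLinearMap (AddMonoidHom.mk'
      (fun x => w * aeval w (derivative (r x))) (fun x y => by
        rw [key' (r (x + y)) (r x + r y) (by simp [hr])]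
        simp [mul_add]))) (fun x y => by
        change w * aeval w (derivative (r (x * y))) = x * (w * aeval w (derivative (r y))) +
          y * (w * aeval w (derivative (r x)))
        rw [key' (r (x * y)) (r x * r y) (by simp [hr])]
        simp only [derivative_mul, map_add, map_mul, hr]
        ring)
  have hD : ∀ P : E[X], D (aeval w P) = w * aeval w (derivative P) := fun P =>
    key' _ _ (hr _)
  refine ⟨D, by simpa using hD X, fun y z hyz => ?_, fun y => ?_⟩
  swap
  · have hp1 : p - 1 + 1 = p := Nat.sub_add_cancel (Fact.out : p.Prime).one_le
    rw [← hr y]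
    generalize r y = P
    induction P using Polynomial.induction_on' with
    | add P Q hP hQ =>
      obtain ⟨z₁, hz₁⟩ := hP
      obtain ⟨z₂, hz₂⟩ := hQ
      obtain ⟨h, hh⟩ := exists_derivation_add_pow_sub_one_mul (p := p) D (aeval w P) (aeval w Q)
      refine ⟨z₁ + z₂ + h, ?_⟩
      rw [map_add (aeval w), hh, map_add D, map_add D, map_add D, add_pow_char, ← hz₁, ← hz₂]
      ring
    | monomial j e =>
      refine ⟨0, ?_⟩
      have h1 : D (aeval w (monomial j e)) = (j : F) * aeval w (monomial j e) := by
        rw [hD, derivative_monomial, aeval_monomial, aeval_monomial]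
        rcases j with _ | j
        · simp
        · simp only [map_mul, map_natCast, Nat.add_sub_cancel, pow_succ]
          ring
      have hj : (j : F) ^ p = j := map_natCast (frobenius F p) j
      generalize aeval w (monomial j e) = m at h1 ⊢
      have hm : m ^ (p - 1) * m = m ^ p := by rw [← pow_succ, hp1]
      rw [h1, map_zero, mul_pow, hj]
      linear_combination (j : F) * hm
  have hmonic := monic_X_pow_sub_C (⟨w ^ p, hE w⟩ : E) (Fact.out : p.Prime).ne_zero
  obtain ⟨P, hPy, hPd⟩ : ∃ P : E[X], aeval w P = y ∧ P.degree < p := by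
    refine ⟨r y %ₘ (X ^ p - C (⟨w ^ p, hE w⟩ : E)), ?_, ?_⟩
    · conv_rhs => rw [← hr y, ← modByMonic_add_div (r y) (X ^ p - C (⟨w ^ p, hE w⟩ : E))]
      have h0 : aeval w (X ^ p - C (⟨w ^ p, hE w⟩ : E) : E[X]) = 0 := by
        simp [sub_eq_zero]; rfl
      rw [map_add, map_mul, h0, zero_mul, add_zero]
    · exact (degree_modByMonic_lt _ hmonic).trans_eq
        (degree_X_pow_sub_C (Fact.out : p.Prime).pos _)
  have hQ : X * derivative P - C (⟨z ^ p, hE z⟩ : E) = 0 := by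
    refine eq_zero_of_aeval_eq_zero_of_degree_lt E hE hwE ?_ ?_
    · rw [map_sub, map_mul, aeval_X, ← hD, hPy, hyz, aeval_C, sub_eq_zero]; rfl
    · refine (degree_sub_le _ _).trans_lt (max_lt ?_ ?_)
      · rcases eq_or_ne P 0 with rfl | hP0
        · simp
        rcases eq_or_ne (derivative P) 0 with h | h
        · simp [h]
        rw [degree_mul, degree_X, degree_eq_natDegree h]
        rw [degree_eq_natDegree hP0] at hPd
        have h1 : P.natDegree ≠ 0 := fun h1 => h (derivative_of_natDegree_zero h1)
        have := natDegree_derivative_lt h1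
        norm_cast at hPd ⊢
        omega
      · refine degree_C_le.trans_lt ?_
        exact_mod_cast (Fact.out : p.Prime).pos
  have := congrArg (fun P => Polynomial.coeff P 0) hQ
  simp only [coeff_sub, mul_coeff_zero, coeff_X_zero, zero_mul, coeff_C_zero, zero_sub,
    Polynomial.coeff_zero, neg_eq_zero] at this
  have h2 : z ^ p = 0 := congrArg Subtype.val this
  exact pow_eq_zero_iff (Fact.out : p.Prime).ne_zero |>.mp h2

/-- If `∑ w_i ^ (p ^ i - 1) δ(w_i)` vanishes for a derivation as in `exists_derivation_eq_self`,
then so does `δ` of the last entry: apply the Cartier operator repeatedly. -/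
theorem derivation_last_eq_zero (D : Derivation ℤ F F) (hD : ∀ y z : F, D y = z ^ p → z = 0)
    (hD' : ∀ y : F, ∃ z : F, y ^ (p - 1) * D y - D y ^ p = D z) (r : ℕ) (w : ℕ → F)
    (h : ∑ i ∈ Finset.range (r + 1), w i ^ (p ^ i - 1) * D (w i) = 0) : D (w r) = 0 := by
  induction r generalizing w with
  | zero => simpa using h
  | succ r ih =>
    refine ih (fun i => w (i + 1)) ?_
    choose c hc using hD'
    refine hD (-(w 0 + ∑ i ∈ Finset.range (r + 1),
      (w (i + 1) ^ (p ^ i - 1)) ^ p * c (w (i + 1)))) _ ?_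
    rw [Finset.sum_range_succ'] at h
    simp only [pow_zero, Nat.sub_self, one_mul] at h
    rw [sum_pow_char, map_neg, map_add, map_sum, neg_eq_iff_add_eq_zero, ← h, add_comm (D (w 0)),
      add_right_comm, ← Finset.sum_add_distrib]
    congr 1
    refine Finset.sum_congr rfl fun i _ => ?_
    rw [Derivation.map_pow_char_mul, ← hc]
    have h1 : p ^ (i + 1) - 1 = (p ^ i - 1) * p + (p - 1) := by
      have h2 := Nat.one_le_pow i p (Fact.out : p.Prime).pos
      have h3 := (Fact.out : p.Prime).one_le
      zify [h2, h3, Nat.one_le_pow (i + 1) p (Fact.out : p.Prime).pos]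
      ring
    rw [h1, pow_add, pow_mul]
    ring

/-- The kernel of `(w_i) ↦ ∑ w_i ^ (p ^ i - 1) d w_i` consists of `p`-th powers. -/
theorem exists_pow_eq_of_forall_derivation (r : ℕ) (w : ℕ → F)
    (h : ∀ D : Derivation ℤ F F, ∑ i ∈ Finset.range r, w i ^ (p ^ i - 1) * D (w i) = 0) :
    ∀ i < r, ∃ u : F, u ^ p = w i := by
  induction r with
  | zero => simp
  | succ r ih =>
    have hr : ∃ u : F, u ^ p = w r := by
      by_contra! hw
      obtain ⟨D, hDw, hD, hD'⟩ := exists_derivation_eq_self (p := p) hw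
      have h0 := derivation_last_eq_zero (p := p) D hD hD' r w (h D)
      refine hw 0 ?_
      rw [← hDw, h0, zero_pow (Fact.out : p.Prime).ne_zero]
    intro i hi
    rcases Nat.lt_succ_iff_lt_or_eq.mp hi with hi | rfl
    · refine ih (fun D => ?_) i hi
      obtain ⟨u, hu⟩ := hr
      have := h D
      rw [Finset.sum_range_succ, ← hu] at this
      simpa [D.leibniz_pow] using this
    · exact hr

/-- Homomorphisms from a field of characteristic `p` lift along square-zero extensions. -/
theorem exists_lift_of_sq_eq_bot {B : Type*} [CommRing B] [CharP B p] (I : Ideal B)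
    (hI : I ^ 2 = ⊥) (f : F →+* B ⧸ I) :
    ∃ g : F →+* B, (Ideal.Quotient.mk I).comp g = f := by
  have hp0 : p ≠ 0 := (Fact.out : p.Prime).ne_zero
  have : CharP (F × B) p := ⟨fun x => by
    rw [← CharP.cast_eq_zero_iff F p x, Prod.ext_iff]
    simp only [Prod.fst_natCast, Prod.snd_natCast, Prod.fst_zero, Prod.snd_zero,
      CharP.cast_eq_zero_iff F p, CharP.cast_eq_zero_iff B p, and_self]⟩
  have hIp : ∀ b ∈ I, b ^ p = 0 := fun b hb => by
    have h : b ^ 2 ∈ I ^ 2 := Ideal.pow_mem_pow hb 2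
    rw [hI, Ideal.mem_bot] at h
    exact pow_eq_zero_of_le (Fact.out : p.Prime).two_le h
  let P : Subring (F × B) := (f.comp (RingHom.fst F B)).eqLocus
    ((Ideal.Quotient.mk I).comp (RingHom.snd F B))
  have hP : ∀ z : F × B, z ∈ P ↔ f z.1 = Ideal.Quotient.mk I z.2 := fun z => Iff.rfl
  obtain ⟨Γ, -, hmax⟩ := zorn_le_nonempty₀
    {Γ : Subring (F × B) | Γ ≤ P ∧ (∀ b : B, ((0 : F), b) ∈ Γ → b = 0) ∧ ∀ z ∈ P, z ^ p ∈ Γ}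
    (fun c hc hchain Γ₀ hΓ₀ => by
      refine ⟨sSup c, ⟨sSup_le fun Γ hΓ => (hc hΓ).1, fun b hb => ?_, fun z hz => ?_⟩,
        fun z hz => le_sSup hz⟩
      · rw [Subring.mem_sSup_of_directedOn ⟨Γ₀, hΓ₀⟩ hchain.directedOn] at hb
        obtain ⟨Γ, hΓ, hb⟩ := hb
        exact (hc hΓ).2.1 b hb
      · exact le_sSup hΓ₀ ((hc hΓ₀).2.2 z hz)) (P.map (frobenius (F × B) p)) (by
      refine ⟨?_, fun b hb => ?_, fun z hz => ⟨z, hz, rfl⟩⟩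
      · rintro _ ⟨z, hz, rfl⟩
        exact P.pow_mem hz p
      · obtain ⟨⟨x, b'⟩, hz, hz'⟩ := hb
        simp only [frobenius_def, Prod.pow_mk, Prod.mk.injEq] at hz'
        have hx : x = 0 := pow_eq_zero_iff hp0 |>.mp hz'.1
        subst hx
        have hb' : f 0 = Ideal.Quotient.mk I b' := hz
        rw [map_zero, eq_comm, Ideal.Quotient.eq_zero_iff_mem] at hb'
        rw [← hz'.2, hIp b' hb'])
  obtain ⟨hΓP, hΓ0, hΓp⟩ := hmax.prop
  have hlift : ∀ x : F, ∃ b : B, (x, b) ∈ P := fun x => by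
    obtain ⟨b, hb⟩ := Ideal.Quotient.mk_surjective (f x)
    exact ⟨b, hb.symm⟩
  let E : Subfield F :=
    { Γ.map (RingHom.fst F B) with
      inv_mem' := by
        rintro _ ⟨⟨x, b⟩, hz, rfl⟩
        change x⁻¹ ∈ Γ.map (RingHom.fst F B)
        rcases eq_or_ne x 0 with rfl | hx
        · rw [inv_zero]
          exact zero_mem _
        obtain ⟨c, hc⟩ := hlift x⁻¹
        refine ⟨(x, b) ^ (p - 1) * (x⁻¹, c) ^ p, Γ.mul_mem (Γ.pow_mem hz _) (hΓp _ hc), ?_⟩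
        obtain ⟨q, hq⟩ := Nat.exists_eq_succ_of_ne_zero hp0
        simp [hq, pow_succ, hx] }
  have hEmem : ∀ x, x ∈ E ↔ ∃ b, (x, b) ∈ Γ := fun x =>
    ⟨fun ⟨⟨y, b⟩, hz, hy⟩ => ⟨b, by subst hy; exact hz⟩, fun ⟨b, hb⟩ => ⟨(x, b), hb, rfl⟩⟩
  have hE : ∀ x : F, x ^ p ∈ E := fun x => by
    obtain ⟨b, hb⟩ := hlift x
    exact (hEmem _).2 ⟨b ^ p, hΓp _ hb⟩
  have hall : ∀ x : F, ∃ b, (x, b) ∈ Γ := by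
    intro w
    by_contra hw
    rw [← hEmem] at hw
    obtain ⟨b, hb⟩ := hlift w
    let γ : Γ := ⟨(w, b) ^ p, hΓp _ hb⟩
    let φ : Γ →+* E := (RingHom.fst F B).restrict Γ E fun z hz => (hEmem _).2 ⟨z.2, hz⟩
    have hφ : ∀ z : Γ, φ z = 0 → z = 0 := by
      rintro ⟨⟨x, c⟩, hz⟩ h
      have hx : x = 0 := congrArg Subtype.val h
      subst hx
      have := hΓ0 c hz
      subst this
      rfl
    let Γ' : Subring (F × B) := (aeval (R := Γ) ((w, b) : F × B)).toRingHom.range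
    have hΓΓ' : Γ ≤ Γ' := fun z hz => ⟨C ⟨z, hz⟩, by simp; rfl⟩
    have hwΓ' : (w, b) ∈ Γ' := ⟨X, by simp⟩
    have hmem : Γ' ≤ Γ := by
      refine hmax.le_of_ge ⟨?_, fun c hc => ?_, fun z hz => hΓΓ' (hΓp z hz)⟩ hΓΓ'
      · rintro _ ⟨Q, rfl⟩
        change aeval ((w, b) : F × B) Q ∈ P
        rw [aeval_eq_sum_range]
        exact P.sum_mem fun i _ => P.mul_mem (hΓP (Q.coeff i).2) (P.pow_mem hb i)
      · obtain ⟨Q, hQ⟩ := hc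
        change aeval ((w, b) : F × B) Q = _ at hQ
        have hmonic := monic_X_pow_sub_C γ hp0
        have h0 : aeval ((w, b) : F × B) (X ^ p - C γ) = 0 := by
          simp only [map_sub, map_pow, aeval_X, aeval_C]
          exact sub_self _
        rw [← modByMonic_add_div Q (X ^ p - C γ), map_add, map_mul, h0, zero_mul,
          add_zero] at hQ
        have : Nontrivial Γ := inferInstance
        have hd : (Q %ₘ (X ^ p - C γ)).degree < p := (degree_modByMonic_lt _ hmonic).trans_eq
          (degree_X_pow_sub_C (Fact.out : p.Prime).pos _)
        generalize Q %ₘ (X ^ p - C γ) = Q at hQ hd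
        have hQ0 : Q.map φ = 0 := by
          refine eq_zero_of_aeval_eq_zero_of_degree_lt E hE hw ?_ ((degree_map_le).trans_lt hd)
          have := congrArg Prod.fst hQ
          rw [aeval_eq_sum_range, Prod.fst_sum] at this
          rw [aeval_def, eval₂_map, eval₂_eq_sum_range]
          exact this
        have hQ1 : Q = 0 := by
          ext1 i
          refine hφ _ ?_
          rw [← coeff_map, hQ0, Polynomial.coeff_zero]
        rw [hQ1, map_zero] at hQ
        exact (congrArg Prod.snd hQ).symm
    exact hw ((hEmem w).2 ⟨b, hmem hwΓ'⟩)
  choose g hg using hall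
  have huniq : ∀ x b, (x, b) ∈ Γ → b = g x := fun x b hb => by
    have := Γ.sub_mem hb (hg x)
    rw [Prod.mk_sub_mk, sub_self] at this
    exact sub_eq_zero.mp (hΓ0 _ this)
  refine ⟨{ toFun := g
            map_one' := (huniq 1 1 Γ.one_mem).symm
            map_mul' := fun x y => (huniq _ _ (Γ.mul_mem (hg x) (hg y))).symm
            map_zero' := (huniq 0 0 Γ.zero_mem).symm
            map_add' := fun x y => (huniq _ _ (Γ.add_mem (hg x) (hg y))).symm }, ?_⟩
  ext x
  exact (hΓP (hg x)).symm

theorem Algebra.FormallySmooth.of_charP [Algebra (ZMod p) F] :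
    Algebra.FormallySmooth (ZMod p) F := by
  refine .of_comp_surjective fun B _ _ I hI f => ?_
  rcases subsingleton_or_nontrivial B with hB | hB
  · refine ⟨AlgHom.ofLinearMap 0 (Subsingleton.elim _ _) fun _ _ => Subsingleton.elim _ _, ?_⟩
    ext x
    obtain ⟨b, hb⟩ := Ideal.Quotient.mk_surjective (f x)
    rw [← hb, Subsingleton.elim b 0]
    simp
  have : CharP B p := charP_of_injective_algebraMap (algebraMap (ZMod p) B).injective p
  obtain ⟨g, hg⟩ := exists_lift_of_sq_eq_bot (p := p) I hI f.toRingHom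
  refine ⟨{ g with commutes' := fun r => ?_ }, ?_⟩
  · exact congrArg (fun h : ZMod p →+* B => h r) (Subsingleton.elim (g.comp (algebraMap _ _)) _)
  · ext x
    exact congrArg (fun h : F →+* B ⧸ I => h x) hg

end PthRoots

section PowerSeries

/-- The `L`-jet evaluation of power series at a nilpotent element is multiplicative. -/
theorem PowerSeries.eval₂_trunc_mul {A B : Type*} [CommRing A] [CommRing B] (σ : A →+* B) (t : B)
    (L : ℕ) (ht : t ^ L = 0) (f g : PowerSeries A) :
    (trunc L (f * g)).eval₂ σ t = (trunc L f).eval₂ σ t * (trunc L g).eval₂ σ t := by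
  have key : ∀ P : Polynomial A, (trunc L (P : PowerSeries A)).eval₂ σ t = P.eval₂ σ t := by
    intro P
    have hdvd : (Polynomial.X ^ L : Polynomial A) ∣ P - trunc L (P : PowerSeries A) := by
      rw [Polynomial.X_pow_dvd_iff]
      intro d hd
      simp [coeff_trunc, hd]
    obtain ⟨Q, hQ⟩ := hdvd
    rw [eq_comm, ← sub_eq_zero, ← Polynomial.eval₂_sub, hQ, Polynomial.eval₂_mul]
    simp [ht]
  rw [← trunc_trunc_mul_trunc, ← Polynomial.coe_mul, key, Polynomial.eval₂_mul]

/-- A ring with a nonzerodivisor `π` generating an ideal `I`, along which the quotient map has a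
section into the `I`-adic completion, embeds `π`-adically into power series over the quotient. -/
theorem exists_ringHom_powerSeries {R : Type*} [CommRing R] [IsDomain R] (π : R) (hπ : π ≠ 0)
    (I : Ideal R) (hI : I = Ideal.span {π}) (σ : (R ⧸ I) →+* AdicCompletion I R)
    (hσ : ∀ x, AdicCompletion.evalOneₐ I (σ x) = x) :
    ∃ φ : R →+* PowerSeries (R ⧸ I), φ π = PowerSeries.X ∧
      ∀ a, PowerSeries.constantCoeff (φ a) = Ideal.Quotient.mk I a := by
  let ι := algebraMap R (AdicCompletion I R)
  let e : (L : ℕ) → AdicCompletion I R →+* R ⧸ I ^ L := fun L =>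
    (AdicCompletion.evalₐ I L).toRingHom
  have heι : ∀ L r, e L (ι r) = Ideal.Quotient.mk (I ^ L) r := fun L r =>
    (AdicCompletion.evalₐ I L).commutes r
  have hev : ∀ r, AdicCompletion.evalOneₐ I (ι r) = Ideal.Quotient.mk I r := fun r =>
    (AdicCompletion.evalOneₐ I).commutes r
  have hker : ∀ x, AdicCompletion.evalOneₐ I x = 0 → ∃ y, x = ι π * y := by
    intro x hx
    have h : x ∈ RingHom.ker (AdicCompletion.evalOneₐ I).toRingHom := hx
    rw [AdicCompletion.ker_evalOneₐ_eq_map I ⟨{π}, by simp [hI]⟩] at h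
    have h2 : I.map ι ≤ Ideal.span {ι π} := by
      refine Ideal.map_le_iff_le_comap.mpr (hI.le.trans ?_)
      rw [Ideal.span_singleton_le_iff_mem, Ideal.mem_comap]
      exact Ideal.mem_span_singleton_self _
    exact Ideal.mem_span_singleton.mp (h2 h)
  have heπ : ∀ L, e L (ι π) ^ L = 0 := fun L => by
    rw [heι, ← map_pow, Ideal.Quotient.eq_zero_iff_mem]
    exact Ideal.pow_mem_pow (hI ▸ Ideal.mem_span_singleton_self π) L
  have hstep : ∀ x, ∃ y, x = σ (AdicCompletion.evalOneₐ I x) + ι π * y := fun x => by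
    obtain ⟨y, hy⟩ := hker (x - σ (AdicCompletion.evalOneₐ I x)) (by rw [map_sub, hσ, sub_self])
    exact ⟨y, by rw [← hy]; ring⟩
  choose sh hsh using hstep
  let ψ : (L : ℕ) → PowerSeries (R ⧸ I) → R ⧸ I ^ L := fun L f =>
    (PowerSeries.trunc L f).eval₂ ((e L).comp σ) (e L (ι π))
  have hψ_add : ∀ L f g, ψ L (f + g) = ψ L f + ψ L g := fun L f g => by
    simp only [ψ, map_add, Polynomial.eval₂_add]
  have hψ_mul : ∀ L f g, ψ L (f * g) = ψ L f * ψ L g := fun L f g =>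
    PowerSeries.eval₂_trunc_mul _ _ L (heπ L) f g
  have hψ_sub : ∀ L f g, ψ L (f - g) = ψ L f - ψ L g := fun L f g => by
    rw [eq_sub_iff_add_eq, ← hψ_add, sub_add_cancel]
  have hψ_C : ∀ L c, ψ L (PowerSeries.C c) = e L (σ c) := by
    intro L c
    rcases L with _ | L
    · have : Subsingleton (R ⧸ I ^ 0) := by
        rw [Ideal.Quotient.subsingleton_iff, pow_zero, Ideal.one_eq_top]
      exact Subsingleton.elim _ _
    · simp [ψ]
  have hψ_X : ∀ L, ψ L PowerSeries.X = e L (ι π) := by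
    intro L
    rcases L with _ | _ | L
    · have : Subsingleton (R ⧸ I ^ 0) := by
        rw [Ideal.Quotient.subsingleton_iff, pow_zero, Ideal.one_eq_top]
      exact Subsingleton.elim _ _
    · have := (pow_one (e 1 (ι π))).symm.trans (heπ 1)
      change ψ 1 PowerSeries.X = e 1 (ι π)
      rw [this]
      simp only [ψ, PowerSeries.eval₂_trunc_eq_sum_range]
      simp
    · simp [ψ, PowerSeries.trunc_X]
  have hinj : ∀ f, (∀ L, ψ L f = 0) → f = 0 := by
    intro f hf
    ext k
    rw [map_zero]
    induction k using Nat.strong_induction_on with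
    | _ k ih =>
    have h := hf (k + 1)
    simp only [ψ, PowerSeries.eval₂_trunc_eq_sum_range] at h
    rw [Finset.sum_range_succ, Finset.sum_eq_zero, zero_add] at h
    · obtain ⟨r, hr⟩ := Ideal.Quotient.mk_surjective (PowerSeries.coeff k f)
      obtain ⟨y, hy⟩ := hker (σ (PowerSeries.coeff k f) - ι r)
        (by rw [map_sub, hσ, hev, hr, sub_self])
      rw [RingHom.comp_apply, eq_add_of_sub_eq hy, map_add, add_mul, map_mul, mul_right_comm,
        ← pow_succ', heπ, zero_mul, zero_add, heι, heι, ← map_pow, ← map_mul,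
        Ideal.Quotient.eq_zero_iff_mem] at h
      have h2 : ∀ J : Ideal R, J = Ideal.span {π} → r * π ^ k ∈ J ^ (k + 1) → r ∈ J := by
        rintro J rfl hJ
        rwa [Ideal.span_singleton_pow, Ideal.mem_span_singleton, pow_succ',
          mul_dvd_mul_iff_right (pow_ne_zero k hπ), ← Ideal.mem_span_singleton] at hJ
      rw [← hr, Ideal.Quotient.eq_zero_iff_mem]
      exact h2 I hI h
    · intro i hi
      rw [ih i (Finset.mem_range.mp hi), map_zero, zero_mul]
  have hex : ∀ a, ∃ f : PowerSeries (R ⧸ I), ∀ L, ψ L f = Ideal.Quotient.mk (I ^ L) a := by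
    intro a
    let f := PowerSeries.mk fun i => AdicCompletion.evalOneₐ I (sh^[i] (ι a))
    have hdig : ∀ k, ι a = ∑ i ∈ Finset.range k,
        σ (AdicCompletion.evalOneₐ I (sh^[i] (ι a))) * ι π ^ i + ι π ^ k * sh^[k] (ι a) := by
      intro k
      induction k with
      | zero => simp
      | succ k ih =>
        rw [Finset.sum_range_succ, add_assoc, Function.iterate_succ_apply', pow_succ, mul_assoc,
          mul_comm _ (ι π ^ k), ← mul_add, ← hsh]
        exact ih
    refine ⟨f, fun L => ?_⟩
    rw [← heι, hdig L, map_add, map_mul, map_pow, heπ, zero_mul, add_zero, map_sum]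
    simp only [ψ, PowerSeries.eval₂_trunc_eq_sum_range, f, PowerSeries.coeff_mk]
    simp
  choose φ hφ using hex
  have huniq : ∀ a f, (∀ L, ψ L f = Ideal.Quotient.mk (I ^ L) a) → φ a = f := fun a f h =>
    sub_eq_zero.mp (hinj _ fun L => by rw [hψ_sub, hφ, h, sub_self])
  refine ⟨{ toFun := φ
            map_one' := huniq _ _ fun L => by
              rw [← map_one PowerSeries.C, hψ_C, map_one, map_one, map_one]
            map_mul' := fun a b => huniq _ _ fun L => by rw [hψ_mul, hφ, hφ, map_mul]
            map_zero' := huniq _ _ fun L => by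
              rw [← map_zero PowerSeries.C, hψ_C, map_zero, map_zero, map_zero]
            map_add' := fun a b => huniq _ _ fun L => by rw [hψ_add, hφ, hφ, map_add] },
    huniq _ _ fun L => by rw [hψ_X, heι], fun a => ?_⟩
  have h := hφ a 1
  obtain ⟨r, hr⟩ := Ideal.Quotient.mk_surjective (PowerSeries.constantCoeff (φ a))
  change PowerSeries.constantCoeff (φ a) = _
  obtain ⟨y, hy⟩ := hker (σ (PowerSeries.constantCoeff (φ a)) - ι r)
    (by rw [map_sub, hσ, hev, hr, sub_self])
  simp only [ψ, PowerSeries.eval₂_trunc_eq_sum_range] at h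
  have hπ1 := (pow_one (e 1 (ι π))).symm.trans (heπ 1)
  rw [Finset.sum_range_one, pow_zero, mul_one, PowerSeries.coeff_zero_eq_constantCoeff_apply,
    RingHom.comp_apply, eq_add_of_sub_eq hy, map_add, map_mul, hπ1, zero_mul, zero_add, heι,
    Ideal.Quotient.eq, pow_one] at h
  rw [← hr, Ideal.Quotient.eq]
  exact h

end PowerSeries

section DiscreteAddValuation

variable {K : Type*} [Field K] {v : AddValuation K (WithTop ℤ)}

theorem AddValuation.exists_eq_coe (v : AddValuation K (WithTop ℤ)) {x : K} (hx : x ≠ 0) :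
    ∃ m : ℤ, v x = m :=
  (WithTop.ne_top_iff_exists.mp ((AddValuation.ne_top_iff v).mpr hx)).imp fun _ h => h.symm

theorem AddValuation.ne_zero_of_eq_one {π : K} (hπ : v π = 1) : π ≠ 0 := by
  rintro rfl
  simp at hπ

theorem AddValuation.map_zpow_of_eq_one {π : K} (hπ : v π = 1) (m : ℤ) :
    v (π ^ m) = (m : WithTop ℤ) := by
  have hnat : ∀ n : ℕ, v (π ^ n) = ((n : ℤ) : WithTop ℤ) := fun n => by
    rw [AddValuation.map_pow, hπ]
    simp
  obtain ⟨n, rfl | rfl⟩ := m.eq_nat_or_neg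
  · simpa using hnat n
  · have hne : π ^ (-(n : ℤ)) ≠ 0 := zpow_ne_zero _ (AddValuation.ne_zero_of_eq_one hπ)
    obtain ⟨k, hk⟩ := v.exists_eq_coe hne
    have h : v (π ^ (-(n : ℤ)) * π ^ n) = 0 := by
      rw [zpow_neg, zpow_natCast,
        inv_mul_cancel₀ (pow_ne_zero _ (AddValuation.ne_zero_of_eq_one hπ)),
        AddValuation.map_one]
    rw [AddValuation.map_mul, hk, hnat] at h
    rw [hk]
    norm_cast at h ⊢
    lia

theorem AddValuation.coe_le_map_iff {π : K} (hπ : v π = 1) (m : ℤ) (x : K) :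
    (m : WithTop ℤ) ≤ v x ↔ 0 ≤ v (π ^ (-m) * x) := by
  rcases eq_or_ne x 0 with rfl | hx
  · simp
  obtain ⟨k, hk⟩ := v.exists_eq_coe hx
  rw [AddValuation.map_mul, AddValuation.map_zpow_of_eq_one hπ, hk]
  norm_cast
  lia

theorem AddValuation.one_le_map_iff {x : K} : 1 ≤ v x ↔ 0 < v x := by
  rcases eq_or_ne x 0 with rfl | hx
  · simp
  obtain ⟨k, hk⟩ := v.exists_eq_coe hx
  rw [hk]
  norm_cast

/-- A discretely valued field of characteristic `p` embeds into Laurent series over its residue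
field, compatibly with the valuation. -/
theorem exists_ringHom_laurentSeries.{u} {K : Type u} [Field K] {v : AddValuation K (WithTop ℤ)}
    {p : ℕ} [Fact p.Prime] [CharP K p] {π : K} (hπ : v π = 1) :
    ∃ (F : Type u) (_ : Field F) (_ : CharP F p) (Φ : K →+* LaurentSeries F),
      Φ π = HahnSeries.single 1 1 ∧ (∀ x, 0 ≤ v x → ∀ k < 0, (Φ x).coeff k = 0) ∧
      (∀ x, 0 ≤ v x → (Φ x).coeff 0 = 0 → 0 < v x) ∧
      ∀ u : F, ∃ x, 0 ≤ v x ∧ (Φ x).coeff 0 = u := by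
  let R := v.toValuation.valuationSubring
  have hR : ∀ x, x ∈ R ↔ 0 ≤ v x := fun x => Iff.rfl
  let I := IsLocalRing.maximalIdeal R
  have hI' : ∀ x : R, x ∈ I ↔ 0 < v x := fun x =>
    Valuation.mem_maximalIdeal_iff K v.toValuation
  let π' : R := ⟨π, (hR π).2 (by rw [hπ]; exact zero_le_one)⟩
  have hπ0 := AddValuation.ne_zero_of_eq_one hπ
  have hπ' : π' ≠ 0 := fun h => hπ0 (congrArg Subtype.val h)
  have hI : I = Ideal.span {π'} := by
    ext x
    rw [hI', Ideal.mem_span_singleton, ← AddValuation.one_le_map_iff]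
    constructor
    · intro h
      have h1 := (AddValuation.coe_le_map_iff hπ 1 x).mp (by exact_mod_cast h)
      refine ⟨⟨_, (hR _).2 h1⟩, Subtype.ext ?_⟩
      change (x : K) = π * (π ^ (-1 : ℤ) * x)
      field_simp
    · rintro ⟨y, rfl⟩
      change 1 ≤ v (π * y)
      rw [AddValuation.map_mul, hπ]
      exact le_add_of_nonneg_right ((hR _).1 y.2)
  let : Field (R ⧸ I) := Ideal.Quotient.field I
  have : CharP R p := (RingHom.charP_iff R.subtype R.subtype_injective p).mpr inferInstance
  let : Algebra (ZMod p) R := ZMod.algebra R p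
  have : CharP (R ⧸ I) p :=
    charP_of_injective_algebraMap (algebraMap (ZMod p) (R ⧸ I)).injective p
  have : Algebra.FormallySmooth (ZMod p) (R ⧸ I) := .of_charP
  obtain ⟨σ, hσ⟩ := Algebra.FormallySmooth.exists_adicCompletionEvalOneₐ_comp_eq
    (AlgHom.id (ZMod p) (R ⧸ I))
  obtain ⟨φ, hφπ, hφ⟩ := exists_ringHom_powerSeries π' hπ' I hI σ.toRingHom
    (fun x => congrArg (fun f : (R ⧸ I) →ₐ[ZMod p] (R ⧸ I) => f x) hσ)
  have hφ' : ∀ x : R, PowerSeries.constantCoeff (φ x) = 0 ↔ 0 < v x := fun x => by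
    rw [hφ, Ideal.Quotient.eq_zero_iff_mem, hI']
  have hφinj : Function.Injective φ := by
    rw [injective_iff_map_eq_zero]
    intro x hx
    by_contra hx0
    have hx0' : (x : K) ≠ 0 := fun h => hx0 (Subtype.ext h)
    obtain ⟨m, hm⟩ := v.exists_eq_coe hx0'
    have h0m : 0 ≤ m := by
      have := (hR _).1 x.2
      rw [hm] at this
      exact_mod_cast this
    lift m to ℕ using h0m
    have hu : v (π ^ (-(m : ℤ)) * x) = 0 := by
      rw [AddValuation.map_mul, AddValuation.map_zpow_of_eq_one hπ, hm]
      norm_cast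
      simp
    let u : R := ⟨_, (hR _).2 hu.ge⟩
    have hxu : x = π' ^ m * u := Subtype.ext <| by
      change (x : K) = π ^ m * (π ^ (-(m : ℤ)) * x)
      rw [zpow_neg, zpow_natCast, mul_inv_cancel_left₀ (pow_ne_zero _ hπ0)]
    rw [hxu, map_mul, map_pow, hφπ, mul_eq_zero_iff_left (pow_ne_zero _ PowerSeries.X_ne_zero)]
      at hx
    have := (hφ' u).mp (by rw [hx, map_zero])
    exact this.ne' hu
  let Φ : K →+* LaurentSeries (R ⧸ I) := IsFractionRing.lift
    (g := (HahnSeries.ofPowerSeries ℤ (R ⧸ I)).comp φ)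
    (HahnSeries.ofPowerSeries_injective.comp hφinj)
  have hΦ : ∀ x : R, Φ x = HahnSeries.ofPowerSeries ℤ (R ⧸ I) (φ x) := fun x =>
    IsFractionRing.lift_algebraMap _ x
  have hΦ0 : ∀ x : R, (Φ x).coeff 0 = Ideal.Quotient.mk I x := fun x => by
    rw [hΦ, PowerSeries.coeff_coe]
    simpa using hφ x
  refine ⟨R ⧸ I, inferInstance, inferInstance, Φ, ?_, fun x hx k hk => ?_, fun x hx h => ?_,
    fun u => ?_⟩
  · rw [show π = (π' : K) from rfl, hΦ, hφπ, PowerSeries.coe_X]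
  · lift x to R using hx
    rw [hΦ, PowerSeries.coeff_coe, if_pos hk]
  · lift x to R using hx
    rwa [hΦ0, Ideal.Quotient.eq_zero_iff_mem, hI'] at h
  · obtain ⟨x, rfl⟩ := Ideal.Quotient.mk_surjective u
    exact ⟨x, (hR _).1 x.2, hΦ0 x⟩

end DiscreteAddValuation

section LaurentDerivation

variable {F : Type*} [Field F]

theorem LaurentSeries.coeff_mul_eq_zero {f g : LaurentSeries F} {a b : ℤ}
    (hf : ∀ k < a, f.coeff k = 0) (hg : ∀ k < b, g.coeff k = 0) {k : ℤ} (hk : k < a + b) :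
    (f * g).coeff k = 0 := by
  rw [HahnSeries.coeff_mul]
  refine Finset.sum_eq_zero fun ij hij => ?_
  have h := (Finset.mem_antidiagonal.mp hij).2.2
  rcases lt_or_ge ij.1 a with h1 | h1
  · rw [hf _ h1, zero_mul]
  · rw [hg _ (by lia), mul_zero]

theorem LaurentSeries.coeff_mul_add {f g : LaurentSeries F} {a b : ℤ}
    (hf : ∀ k < a, f.coeff k = 0) (hg : ∀ k < b, g.coeff k = 0) :
    (f * g).coeff (a + b) = f.coeff a * g.coeff b := by
  rw [HahnSeries.coeff_mul]
  have h0 : ∀ ij : ℤ × ℤ, ij.1 + ij.2 = a + b → ij ≠ (a, b) →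
      f.coeff ij.1 * g.coeff ij.2 = 0 := by
    rintro ⟨i, j⟩ h hne
    rcases lt_trichotomy i a with h1 | h1 | h1
    · rw [hf _ h1, zero_mul]
    · exact (hne (Prod.ext h1 (by simp only at h ⊢; lia))).elim
    · rw [hg j (by simp only at h; lia), mul_zero]
  rw [Finset.sum_eq_single (a, b)]
  · exact fun ij hij => h0 ij (Finset.mem_antidiagonal.mp hij).2.2
  · intro hab
    by_contra h
    refine hab (Finset.mem_antidiagonal.mpr ⟨?_, ?_, rfl⟩)
    · exact fun h' => h (by rw [h', zero_mul])
    · exact fun h' => h (by rw [h', mul_zero])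

theorem LaurentSeries.coeff_pow_eq_zero_and {f : LaurentSeries F} {a : ℤ}
    (hf : ∀ k < a, f.coeff k = 0) (q : ℕ) :
    (∀ k < q * a, (f ^ q).coeff k = 0) ∧ (f ^ q).coeff (q * a) = f.coeff a ^ q := by
  induction q with
  | zero =>
    refine ⟨fun k hk => ?_, by simp⟩
    rw [pow_zero, HahnSeries.coeff_one, if_neg]
    simp at hk
    lia
  | succ q ih =>
    have h : ((q + 1 : ℕ) : ℤ) * a = q * a + a := by push_cast; ring
    rw [h, pow_succ]
    refine ⟨fun k hk => coeff_mul_eq_zero ih.1 hf hk, ?_⟩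
    rw [coeff_mul_add ih.1 hf, ih.2, pow_succ]

/-- Applying `a_n ↦ δ a_n + c n a_n` to the coefficients of a Laurent series. -/
noncomputable def Derivation.laurentSeriesFun (δ : Derivation ℤ F F) (c : F)
    (f : LaurentSeries F) : LaurentSeries F where
  coeff n := δ (f.coeff n) + c * n * f.coeff n
  isPWO_support' := f.isPWO_support.mono fun n hn h =>
    hn (by simp only [h, map_zero, mul_zero, add_zero])

theorem Derivation.support_laurentSeriesFun_subset (δ : Derivation ℤ F F) (c : F)
    (f : LaurentSeries F) : (δ.laurentSeriesFun c f).support ⊆ f.support :=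
  fun n hn h => hn (by simp only [laurentSeriesFun, h, map_zero, mul_zero, add_zero])

/-- The extension of a derivation `δ` to Laurent series sending `X` to `c * X`. -/
noncomputable def Derivation.laurentSeries (δ : Derivation ℤ F F) (c : F) :
    LaurentSeries F →+ LaurentSeries F :=
  AddMonoidHom.mk' (δ.laurentSeriesFun c) (fun f g => by
    ext n
    simp only [laurentSeriesFun, HahnSeries.coeff_add, map_add]
    ring)

theorem Derivation.coeff_laurentSeries (δ : Derivation ℤ F F) (c : F) (f : LaurentSeries F)
    (n : ℤ) : (δ.laurentSeries c f).coeff n = δ (f.coeff n) + c * n * f.coeff n :=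
  rfl

theorem Derivation.laurentSeries_mul (δ : Derivation ℤ F F) (c : F) (f g : LaurentSeries F) :
    δ.laurentSeries c (f * g) = f * δ.laurentSeries c g + g * δ.laurentSeries c f := by
  change δ.laurentSeriesFun c (f * g) = f * δ.laurentSeriesFun c g + g * δ.laurentSeriesFun c f
  ext n
  rw [mul_comm g, HahnSeries.coeff_add,
    HahnSeries.coeff_mul_right' g.isPWO_support (δ.support_laurentSeriesFun_subset c g),
    HahnSeries.coeff_mul_left' f.isPWO_support (δ.support_laurentSeriesFun_subset c f),
    ← Finset.sum_add_distrib]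
  simp only [laurentSeriesFun]
  rw [HahnSeries.coeff_mul, map_sum, Finset.mul_sum, ← Finset.sum_add_distrib]
  refine Finset.sum_congr rfl fun ij hij => ?_
  rw [← (Finset.mem_antidiagonal.mp hij).2.2, δ.leibniz]
  push_cast
  simp only [smul_eq_mul]
  ring

theorem Derivation.laurentSeries_single (δ : Derivation ℤ F F) (c : F) :
    δ.laurentSeries c (HahnSeries.single 1 1) = HahnSeries.single 1 c := by
  ext n
  rw [coeff_laurentSeries]
  rcases eq_or_ne n 1 with rfl | h
  · simp
  · simp [HahnSeries.coeff_single_of_ne h]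

end LaurentDerivation

section Kaehler

variable {p : ℕ} [Fact p.Prime] {K F : Type*} [Field K] [CharP K p] [Field F]

theorem mem_Kp {x : K} (hx : x ∈ Kp p K) : ∃ y, y ^ p = x := by
  have h : Kp p K ≤ (frobenius K p).fieldRange :=
    Subfield.closure_le.mpr fun _ ⟨y, hy⟩ => ⟨y, hy⟩
  exact h hx

theorem map_pow_char_mul_of_leibniz {L : Type*} [CommRing L] [CharP L p] (D : L →+ L)
    (hD : ∀ f g, D (f * g) = f * D g + g * D f) (f g : L) : D (f ^ p * g) = f ^ p * D g := by
  have hpow : ∀ n : ℕ, D (f ^ (n + 1)) = (n + 1 : ℕ) * f ^ n * D f := by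
    intro n
    induction n with
    | zero => simp
    | succ n ih =>
      rw [pow_succ, hD, ih]
      push_cast
      ring
  have h0 : D (f ^ p) = 0 := by
    have h := hpow (p - 1)
    rwa [Nat.sub_add_cancel (Fact.out : p.Prime).one_le, CharP.cast_eq_zero, zero_mul,
      zero_mul] at h
  rw [hD, h0, mul_zero, add_zero]

/-- A derivation of Laurent series induces an additive map on the Kähler differentials of a
subfield. -/
theorem exists_addMonoidHom_kaehlerDifferential (Φ : K →+* LaurentSeries F)
    (D : LaurentSeries F →+ LaurentSeries F) (hD : ∀ f g, D (f * g) = f * D g + g * D f) :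
    ∃ T : KaehlerDifferential (Kp p K) K →+ LaurentSeries F,
      ∀ x y, T (x • KaehlerDifferential.D (Kp p K) K y) = Φ x * D (Φ y) := by
  let : Algebra K (LaurentSeries F) := Φ.toAlgebra
  have : CharP (LaurentSeries F) p := (RingHom.charP_iff Φ Φ.injective p).mp inferInstance
  let D' : Derivation (Kp p K) K (LaurentSeries F) := Derivation.mk'
    { toFun := fun x => D (Φ x)
      map_add' := fun x y => by rw [map_add, map_add]
      map_smul' := fun c x => by
        obtain ⟨y, hy⟩ := mem_Kp c.2
        change D (Φ ((c : K) * x)) = Φ c * D (Φ x)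
        rw [← hy, map_mul, map_pow, map_pow_char_mul_of_leibniz D hD] }
    (fun a b => by
      change D (Φ (a * b)) = Φ a * D (Φ b) + Φ b * D (Φ a)
      rw [map_mul, hD])
  refine ⟨D'.liftKaehlerDifferential.toAddMonoidHom, fun x y => ?_⟩
  have h := D'.liftKaehlerDifferential.map_smul x (KaehlerDifferential.D (Kp p K) K y)
  rw [Derivation.liftKaehlerDifferential_comp_D] at h
  exact h

end Kaehler

section LaurentEmbedding

variable {p : ℕ} [Fact p.Prime] {K F : Type*} [Field K] [Field F]
  {v : AddValuation K (WithTop ℤ)} {π : K}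

/-- An embedding of a discretely valued field into Laurent series that is compatible with the
valuation and maps onto the residue field `F`. -/
structure IsLaurentEmbedding (v : AddValuation K (WithTop ℤ)) (π : K) (Φ : K →+* LaurentSeries F) :
    Prop where
  map_uniformizer : Φ π = HahnSeries.single 1 1
  coeff_eq_zero : ∀ x, 0 ≤ v x → ∀ k < 0, (Φ x).coeff k = 0
  pos_of_coeff_eq_zero : ∀ x, 0 ≤ v x → (Φ x).coeff 0 = 0 → 0 < v x
  exists_coeff_eq : ∀ u : F, ∃ x, 0 ≤ v x ∧ (Φ x).coeff 0 = u

namespace IsLaurentEmbedding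

variable {Φ : K →+* LaurentSeries F}

theorem coeff_zpow_mul (h : IsLaurentEmbedding v π Φ) (m k : ℤ) (x : K) :
    (Φ (π ^ m * x)).coeff k = (Φ x).coeff (k - m) := by
  rw [map_mul, map_zpow₀, h.map_uniformizer, ← RatFunc.single_zpow]
  simp [HahnSeries.coeff_single_mul]

theorem coeff_eq_zero_of_le (h : IsLaurentEmbedding v π Φ) (hπ : v π = 1) {m : ℤ} {x : K}
    (hx : (m : WithTop ℤ) ≤ v x) : ∀ k < m, (Φ x).coeff k = 0 := by
  intro k hk
  have := h.coeff_eq_zero _ ((AddValuation.coe_le_map_iff hπ m x).mp hx) (k - m) (by lia)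
  rwa [h.coeff_zpow_mul, sub_neg_eq_add, sub_add_cancel] at this

theorem add_one_le_of_coeff_eq_zero (h : IsLaurentEmbedding v π Φ) (hπ : v π = 1) {m : ℤ} {x : K}
    (hx : (m : WithTop ℤ) ≤ v x) (h0 : (Φ x).coeff m = 0) : ((m + 1 : ℤ) : WithTop ℤ) ≤ v x := by
  rw [AddValuation.coe_le_map_iff hπ] at hx ⊢
  have h1 := h.pos_of_coeff_eq_zero _ hx (by
    rw [h.coeff_zpow_mul, sub_neg_eq_add, zero_add, h0])
  rw [← AddValuation.one_le_map_iff] at h1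
  have h2 := (AddValuation.coe_le_map_iff hπ 1 _).mp (by exact_mod_cast h1)
  rwa [← mul_assoc, ← zpow_add₀ (AddValuation.ne_zero_of_eq_one hπ),
    show (-1 : ℤ) + -m = -(m + 1) by ring] at h2

theorem exists_coeff_eq_of_int (h : IsLaurentEmbedding v π Φ) (hπ : v π = 1) (m : ℤ) (u : F) :
    ∃ x, (m : WithTop ℤ) ≤ v x ∧ (Φ x).coeff m = u := by
  obtain ⟨x, hx, rfl⟩ := h.exists_coeff_eq u
  refine ⟨π ^ m * x, ?_, by rw [h.coeff_zpow_mul, sub_self]⟩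
  rw [AddValuation.map_mul, AddValuation.map_zpow_of_eq_one hπ]
  exact le_add_of_nonneg_right hx

end IsLaurentEmbedding

theorem coe_neg_le_smul_iff (v : AddValuation K (WithTop ℤ)) (n : ℤ) {q : ℕ} (hq : 0 < q) (x : K) :
    ((-n : ℤ) : WithTop ℤ) ≤ q • v x ↔ ((-(n / q) : ℤ) : WithTop ℤ) ≤ v x := by
  rcases eq_or_ne x 0 with rfl | hx
  · obtain ⟨q, rfl⟩ := Nat.exists_eq_add_one.mpr hq
    simp [succ_nsmul]
  obtain ⟨m, hm⟩ := v.exists_eq_coe hx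
  rw [hm, ← WithTop.coe_nsmul, WithTop.coe_le_coe, WithTop.coe_le_coe, nsmul_eq_mul,
    neg_le (a := n / (q : ℤ)), Int.le_ediv_iff_mul_le (by exact_mod_cast hq)]
  constructor <;> intro h <;> linarith

variable (A : ℕ → K) in
/-- If `∑ a_i ^ (p ^ i - 1) d a_i` lies one step deeper than expected, then each `a_i` is a
`p`-th power up to terms one step deeper. -/
theorem exists_sub_pow_of_sum_mem_filOmegaLog [CharP K p] [CharP F p] {Φ : K →+* LaurentSeries F}
    (h : IsLaurentEmbedding v π Φ) (hπ : v π = 1) (s : ℕ) (n : ℤ)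
    (hA : ∀ e < s, ((-(n / (p ^ e : ℕ)) : ℤ) : WithTop ℤ) ≤ v (A e))
    (hsum : ∑ e ∈ Finset.range s, (A e ^ (p ^ e - 1)) • KaehlerDifferential.D (Kp p K) K (A e) ∈
      filOmegaLog p K v π (n - 1)) :
    ∃ C : ℕ → K, ∀ e < s, ((-(n / (p ^ (e + 1) : ℕ)) : ℤ) : WithTop ℤ) ≤ v (C e) ∧
      ((-((n - 1) / (p ^ e : ℕ)) : ℤ) : WithTop ℤ) ≤ v (A e - C e ^ p) := by
  classical
  have hp : p.Prime := Fact.out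
  have hpe : ∀ e, (0 : ℤ) < (p ^ e : ℕ) := fun e => by exact_mod_cast pow_pos hp.pos e
  let w : ℕ → F := fun e =>
    if ((p ^ e : ℕ) : ℤ) ∣ n then (Φ (A e)).coeff (-(n / (p ^ e : ℕ))) else 0
  have key : ∀ (δ : Derivation ℤ F F) (c : F), ∑ e ∈ Finset.range s,
      w e ^ (p ^ e - 1) * (δ (w e) + c * (-(n / (p ^ e : ℕ)) : ℤ) * w e) = 0 := by
    intro δ c
    obtain ⟨T, hT⟩ := exists_addMonoidHom_kaehlerDifferential (p := p) Φ (δ.laurentSeries c)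
      (δ.laurentSeries_mul c)
    have hD : ∀ {m : ℤ} {f : LaurentSeries F}, (∀ k < m, f.coeff k = 0) →
        ∀ k < m, (δ.laurentSeries c f).coeff k = 0 := fun hf k hk => by
      rw [δ.coeff_laurentSeries, hf k hk, map_zero, mul_zero, add_zero]
    have hvan : ∀ ω ∈ filOmegaLog p K v π (n - 1), (T ω).coeff (-n) = 0 := by
      intro ω hω
      induction hω using AddSubgroup.closure_induction with
      | mem ω hω =>
        obtain ⟨x, y, hx, hy, rfl | rfl⟩ := hω
        · rw [hT, h.map_uniformizer, δ.laurentSeries_single]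
          refine LaurentSeries.coeff_mul_eq_zero (a := -(n - 1) - 1) (b := 1)
            (h.coeff_eq_zero_of_le hπ ?_) (fun k hk => HahnSeries.coeff_single_of_ne hk.ne) ?_
          · rw [AddValuation.map_mul, AddValuation.map_zpow_of_eq_one hπ]
            exact le_add_of_nonneg_left hx
          · lia
        · rw [hT]
          refine LaurentSeries.coeff_mul_eq_zero (a := -(n - 1)) (b := 0)
            (h.coeff_eq_zero_of_le hπ ?_) (hD (h.coeff_eq_zero y hy)) ?_
          · rw [AddValuation.map_mul, AddValuation.map_zpow_of_eq_one hπ]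
            exact le_add_of_nonneg_left hx
          · lia
      | zero => simp
      | add x y _ _ hx hy => rw [map_add, HahnSeries.coeff_add, hx, hy, add_zero]
      | neg x _ hx => rw [map_neg, HahnSeries.coeff_neg, hx, neg_zero]
    have h0 := hvan _ hsum
    rw [map_sum, HahnSeries.coeff_sum] at h0
    rw [← h0]
    refine Finset.sum_congr rfl fun e he => ?_
    have hAe := h.coeff_eq_zero_of_le hπ (hA e (Finset.mem_range.mp he))
    have hq : ((p ^ e - 1 : ℕ) : ℤ) = (p ^ e : ℕ) - 1 := by
      rw [Nat.cast_sub (Nat.one_le_pow _ _ hp.pos), Nat.cast_one]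
    obtain ⟨hpow0, hpow⟩ := LaurentSeries.coeff_pow_eq_zero_and hAe (p ^ e - 1)
    rw [hT, map_pow]
    by_cases hdvd : ((p ^ e : ℕ) : ℤ) ∣ n
    · have hn : -n = ((p ^ e - 1 : ℕ) : ℤ) * -(n / (p ^ e : ℕ)) + -(n / (p ^ e : ℕ)) := by
        rw [hq]
        linear_combination Int.mul_ediv_cancel' hdvd
      rw [hn, LaurentSeries.coeff_mul_add hpow0 (hD hAe), hpow, δ.coeff_laurentSeries]
      simp only [w, if_pos hdvd]
    · rw [LaurentSeries.coeff_mul_eq_zero hpow0 (hD hAe)]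
      · simp only [w, if_neg hdvd]
        simp
      · rw [hq]
        have h1 := Int.ediv_mul_le n (hpe e).ne'
        have h2 : n / (p ^ e : ℕ) * (p ^ e : ℕ) ≠ n := fun h2 => hdvd ⟨_, by rw [mul_comm, h2]⟩
        have h3 := lt_of_le_of_ne h1 h2
        linarith
  have hpow : ∀ e < s, ∃ u : F, u ^ p = w e := by
    refine exists_pow_eq_of_forall_derivation s w fun δ => ?_
    simpa using key δ 0
  have hzero : ∀ e < s, ((p ^ e : ℕ) : ℤ) ∣ n → ¬ ((p ^ (e + 1) : ℕ) : ℤ) ∣ n → w e = 0 := by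
    intro e he hd hd'
    have h1 := key 0 1
    rw [Finset.sum_eq_single e] at h1
    · have hne : ((-(n / (p ^ e : ℕ)) : ℤ) : F) ≠ 0 := by
        rw [Ne, CharP.intCast_eq_zero_iff F p, dvd_neg]
        rintro ⟨k, hk⟩
        refine hd' ⟨k, ?_⟩
        rw [← Int.mul_ediv_cancel' hd, hk]
        push_cast
        ring
      simp only [Derivation.zero_apply, zero_add, one_mul] at h1
      rcases mul_eq_zero.mp h1 with h2 | h2
      · exact eq_zero_of_pow_eq_zero h2
      · exact (mul_eq_zero.mp h2).resolve_left hne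
    · intro e' _ hne
      simp only [Derivation.zero_apply, zero_add, one_mul]
      rcases lt_or_gt_of_ne hne with hlt | hlt
      · have : ((-(n / (p ^ e' : ℕ)) : ℤ) : F) = 0 := by
          rw [CharP.intCast_eq_zero_iff F p, dvd_neg]
          refine Int.dvd_div_of_mul_dvd ?_
          refine dvd_trans ?_ hd
          exact_mod_cast (pow_succ p e' ▸ pow_dvd_pow p hlt)
        rw [this, zero_mul, mul_zero]
      · have : w e' = 0 := if_neg fun hd'' => hd' (dvd_trans (by
          exact_mod_cast pow_dvd_pow p hlt) hd'')
        rw [this, mul_zero, mul_zero]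
    · exact fun hs => (hs (Finset.mem_range.mpr he)).elim
  have hex : ∀ e, ∃ c : K, e < s → ((-(n / (p ^ (e + 1) : ℕ)) : ℤ) : WithTop ℤ) ≤ v c ∧
      ((-((n - 1) / (p ^ e : ℕ)) : ℤ) : WithTop ℤ) ≤ v (A e - c ^ p) := by
    intro e
    by_cases he : e < s
    swap
    · exact ⟨0, fun h => (he h).elim⟩
    have hAe := hA e he
    have hdeep : ((p ^ e : ℕ) : ℤ) ∣ n → -((n - 1) / (p ^ e : ℕ)) = -(n / (p ^ e : ℕ)) + 1 := by
      rintro ⟨k, hk⟩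
      rw [hk, Int.mul_ediv_cancel_left _ (hpe e).ne',
        show ((p ^ e : ℕ) : ℤ) * k - 1 = -1 + (p ^ e : ℕ) * k by ring,
        Int.add_mul_ediv_left _ _ (hpe e).ne', Int.neg_one_ediv, Int.sign_eq_one_of_pos (hpe e)]
      ring
    by_cases hd : ((p ^ e : ℕ) : ℤ) ∣ n
    swap
    · refine ⟨0, fun _ => ⟨by simp, ?_⟩⟩
      rw [zero_pow hp.ne_zero, sub_zero]
      have h1 : n / (p ^ e : ℕ) ≤ (n - 1) / (p ^ e : ℕ) := by
        rw [Int.le_ediv_iff_mul_le (hpe e)]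
        have h1 := Int.ediv_mul_le n (hpe e).ne'
        have h2 : n / (p ^ e : ℕ) * (p ^ e : ℕ) ≠ n := fun h2 => hd ⟨_, by rw [mul_comm, h2]⟩
        lia
      exact le_trans (WithTop.coe_le_coe.mpr (neg_le_neg h1)) hAe
    by_cases hd' : ((p ^ (e + 1) : ℕ) : ℤ) ∣ n
    swap
    · refine ⟨0, fun _ => ⟨by simp, ?_⟩⟩
      rw [zero_pow hp.ne_zero, sub_zero, hdeep hd]
      have h0 := hzero e he hd hd'
      simp only [w, if_pos hd] at h0
      exact h.add_one_le_of_coeff_eq_zero hπ hAe h0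
    obtain ⟨u, hu⟩ := hpow e he
    obtain ⟨c, hc, hcu⟩ := h.exists_coeff_eq_of_int hπ (-(n / (p ^ (e + 1) : ℕ))) u
    refine ⟨c, fun _ => ⟨hc, ?_⟩⟩
    have hm : -(n / (p ^ e : ℕ)) = p * -(n / (p ^ (e + 1) : ℕ)) := by
      obtain ⟨k, rfl⟩ := hd'
      rw [Int.mul_ediv_cancel_left _ (hpe _).ne', pow_succ]
      push_cast
      rw [mul_assoc, Int.mul_ediv_cancel_left _ (by exact_mod_cast (hpe e).ne')]
      ring
    have hcp : ((-(n / (p ^ e : ℕ)) : ℤ) : WithTop ℤ) ≤ v (c ^ p) := by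
      rw [AddValuation.map_pow, hm]
      have := nsmul_le_nsmul_right hc p
      rwa [← WithTop.coe_nsmul, nsmul_eq_mul] at this
    rw [hdeep hd]
    refine h.add_one_le_of_coeff_eq_zero hπ (AddValuation.map_le_sub v hAe hcp) ?_
    rw [map_sub, HahnSeries.coeff_sub, sub_eq_zero, map_pow]
    simp only [w, if_pos hd] at hu
    rw [← hu, hm, (LaurentSeries.coeff_pow_eq_zero_and (h.coeff_eq_zero_of_le hπ hc) p).2, hcu]
  choose C hC using hex
  exact ⟨C, hC⟩

end LaurentEmbedding

section WittCoeff

variable {p : ℕ} [Fact p.Prime] {R S : Type*} [CommRing R] [CommRing S]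

theorem WittVector.teichmuller_mul_verschiebung [CharP R p] (r : R) (x : WittVector p R) :
    WittVector.teichmuller p r * WittVector.verschiebung x =
      WittVector.verschiebung (WittVector.teichmuller p (r ^ p) * x) := by
  have h : WittVector.frobenius (WittVector.teichmuller p r) =
      WittVector.teichmuller p (r ^ p) := by
    rw [WittVector.frobenius_eq_map_frobenius, WittVector.map_teichmuller, frobenius_def]
  rw [mul_comm, ← WittVector.verschiebung_mul_frobenius, h, mul_comm]

theorem WittVector.coeff_teichmuller_mul [CharP R p] (j : ℕ) (r : R) (x : WittVector p R) :
    (WittVector.teichmuller p r * x).coeff j = r ^ p ^ j * x.coeff j := by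
  induction j generalizing r x with
  | zero => simp [WittVector.mul_coeff_zero]
  | succ j ih =>
    have hdisj : ∀ (a : R) (y : WittVector p R) (n : ℕ),
        (WittVector.teichmuller p a).coeff n = 0 ∨ (WittVector.verschiebung y).coeff n = 0 := by
      rintro a y (_ | n)
      · exact Or.inr (WittVector.verschiebung_coeff_zero y)
      · exact Or.inl (WittVector.teichmuller_coeff_pos p a _ n.succ_pos)
    have hx : WittVector.teichmuller p (x.coeff 0) + WittVector.verschiebung (x.shift 1) = x := by
      ext n
      rw [WittVector.coeff_add_of_disjoint n _ _ (hdisj _ _)]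
      rcases n with _ | n
      · rw [WittVector.verschiebung_coeff_zero, WittVector.teichmuller_coeff_zero, add_zero]
      · rw [WittVector.verschiebung_coeff_succ, WittVector.teichmuller_coeff_pos p _ _ n.succ_pos,
          zero_add, WittVector.shift_coeff, add_comm 1]
    rw [← hx, mul_add, ← map_mul, WittVector.teichmuller_mul_verschiebung,
      WittVector.coeff_add_of_disjoint _ _ _ (hdisj _ _), WittVector.verschiebung_coeff_succ,
      ih, WittVector.coeff_add_of_disjoint _ _ _ (hdisj _ _), WittVector.verschiebung_coeff_succ,
      WittVector.teichmuller_coeff_pos p _ _ j.succ_pos,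
      WittVector.teichmuller_coeff_pos p _ _ j.succ_pos, zero_add, zero_add, ← pow_mul, pow_succ']

theorem WittVector.forall_map_coeff_sub_eq_zero_iff (g : R →+* S) (x y : WittVector p R) (s : ℕ) :
    (∀ j < s, g ((x - y).coeff j) = 0) ↔ ∀ j < s, g (x.coeff j) = g (y.coeff j) := by
  have h : ∀ z w : WittVector p R, WittVector.truncate s (WittVector.map g z) =
      WittVector.truncate s (WittVector.map g w) ↔ ∀ j < s, g (z.coeff j) = g (w.coeff j) := by
    intro z w
    refine ⟨fun h j hj => ?_, fun h => TruncatedWittVector.ext fun i => ?_⟩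
    · simpa only [WittVector.coeff_truncate, WittVector.map_coeff] using
        congrArg (TruncatedWittVector.coeff ⟨j, hj⟩) h
    · rw [WittVector.coeff_truncate, WittVector.coeff_truncate, WittVector.map_coeff,
        WittVector.map_coeff, h i i.is_lt]
  have h0 := h (x - y) 0
  simp only [WittVector.zero_coeff, map_zero] at h0
  rw [← h x y, ← h0, map_sub, map_sub, sub_eq_zero]

theorem WittVector.coeff_iterate_frobenius [CharP R p] (k j : ℕ) (x : WittVector p R) :
    ((WittVector.frobenius^[k]) x).coeff j = x.coeff j ^ p ^ k := by
  induction k with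
  | zero => simp
  | succ k ih =>
    rw [Function.iterate_succ_apply', WittVector.coeff_frobenius_charP, ih, ← pow_mul, pow_succ]

theorem WittVector.iterate_frobenius_sub (k : ℕ) (x y : WittVector p R) :
    (WittVector.frobenius^[k]) (x - y) =
      (WittVector.frobenius^[k]) x - (WittVector.frobenius^[k]) y := by
  induction k with
  | zero => rfl
  | succ k ih => simp only [Function.iterate_succ_apply', ih, map_sub]

end WittCoeff

section WittFiltration

variable {p : ℕ} {K : Type*} [Field K] {v : AddValuation K (WithTop ℤ)} {π : K}

theorem mem_filW_iff {s : ℕ} {n : ℤ} {a : TruncatedWittVector p s K} :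
    a ∈ filW p K v s n ↔
      ∀ i : Fin s, ((-n : ℤ) : WithTop ℤ) ≤ p ^ (s - 1 - (i : ℕ)) • v (a.coeff i) := by
  simp [filW, wittOrd, Finset.le_inf_iff]

variable [Fact p.Prime]

theorem WittVector.forall_pos_coeff_sub_iff {x y : WittVector p K} (hx : ∀ j, 0 ≤ v (x.coeff j))
    (hy : ∀ j, 0 ≤ v (y.coeff j)) (s : ℕ) :
    (∀ j < s, 0 < v ((x - y).coeff j)) ↔ ∀ j < s, 0 < v (x.coeff j - y.coeff j) := by
  let R := v.toValuation.valuationSubring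
  have hpos : ∀ z : R, IsLocalRing.residue R z = 0 ↔ 0 < v (z : K) := fun z => by
    rw [IsLocalRing.residue_eq_zero_iff, Valuation.mem_maximalIdeal_iff]
    rfl
  obtain ⟨x, rfl⟩ : ∃ x' : WittVector p R, x = WittVector.map R.subtype x' :=
    ⟨WittVector.mk p fun j => ⟨x.coeff j, hx j⟩, WittVector.ext fun j => rfl⟩
  obtain ⟨y, rfl⟩ : ∃ y' : WittVector p R, y = WittVector.map R.subtype y' :=
    ⟨WittVector.mk p fun j => ⟨y.coeff j, hy j⟩, WittVector.ext fun j => rfl⟩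
  have h := WittVector.forall_map_coeff_sub_eq_zero_iff (IsLocalRing.residue R) x y s
  have heq : ∀ z w : R, IsLocalRing.residue R z = IsLocalRing.residue R w ↔
      0 < v ((z - w : R) : K) := fun z w => by rw [← sub_eq_zero, ← map_sub, hpos]
  simp only [hpos, heq] at h
  simp only [← map_sub, WittVector.map_coeff]
  exact h

theorem coe_neg_le_smul_iff_nonneg (hπ : v π = 1) (n : ℤ) {q r : ℕ} (hq : 0 < q) (hr : 0 < r)
    (x : K) :
    ((-n : ℤ) : WithTop ℤ) ≤ q • v x ↔ 0 ≤ v ((π ^ n) ^ r * x ^ (q * r)) := by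
  rcases eq_or_ne x 0 with rfl | hx
  · obtain ⟨q, rfl⟩ := Nat.exists_eq_add_one.mpr hq
    simp [succ_nsmul, hr.ne']
  obtain ⟨m, hm⟩ := v.exists_eq_coe hx
  rw [AddValuation.map_mul, AddValuation.map_pow, AddValuation.map_pow,
    AddValuation.map_zpow_of_eq_one hπ, hm, ← WithTop.coe_nsmul, ← WithTop.coe_nsmul,
    ← WithTop.coe_nsmul]
  norm_cast
  have hr' : (0 : ℤ) < r := by exact_mod_cast hr
  have h : r • n + (q * r) • m = (r : ℤ) * (n + q • m) := by
    simp only [nsmul_eq_mul]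
    push_cast
    ring
  rw [h, mul_nonneg_iff_of_pos_left hr']
  lia

theorem coe_neg_sub_one_le_smul_iff_pos (hπ : v π = 1) (n : ℤ) {q r : ℕ} (hq : 0 < q) (hr : 0 < r)
    (x : K) :
    ((-(n - 1) : ℤ) : WithTop ℤ) ≤ q • v x ↔ 0 < v ((π ^ n) ^ r * x ^ (q * r)) := by
  rcases eq_or_ne x 0 with rfl | hx
  · obtain ⟨q, rfl⟩ := Nat.exists_eq_add_one.mpr hq
    simp [succ_nsmul, hr.ne']
  obtain ⟨m, hm⟩ := v.exists_eq_coe hx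
  rw [AddValuation.map_mul, AddValuation.map_pow, AddValuation.map_pow,
    AddValuation.map_zpow_of_eq_one hπ, hm, ← WithTop.coe_nsmul, ← WithTop.coe_nsmul,
    ← WithTop.coe_nsmul]
  norm_cast
  have hr' : (0 : ℤ) < r := by exact_mod_cast hr
  have h : r • n + (q * r) • m = (r : ℤ) * (n + q • m) := by
    simp only [nsmul_eq_mul]
    push_cast
    ring
  rw [h, mul_pos_iff_of_pos_left hr']
  lia

theorem sub_mem_filW_sub_one_iff [CharP K p] (hπ : v π = 1) {s : ℕ} {n : ℤ}
    {a b : TruncatedWittVector p s K} (ha : a ∈ filW p K v s n) (hb : b ∈ filW p K v s n) :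
    a - b ∈ filW p K v s (n - 1) ↔ ∀ i : Fin s,
      ((-(n - 1) : ℤ) : WithTop ℤ) ≤ p ^ (s - 1 - (i : ℕ)) • v (a.coeff i - b.coeff i) := by
  have hp : p.Prime := Fact.out
  let T : WittVector p K → WittVector p K := fun x =>
    WittVector.teichmuller p (π ^ n) * (WittVector.frobenius^[s - 1]) x
  have hTc : ∀ j < s, ∀ x : WittVector p K, (T x).coeff j =
      (π ^ n) ^ p ^ j * x.coeff j ^ (p ^ (s - 1 - j) * p ^ j) := fun j hj x => by
    rw [WittVector.coeff_teichmuller_mul, WittVector.coeff_iterate_frobenius, ← pow_add,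
      Nat.sub_add_cancel (Nat.le_sub_one_of_lt hj)]
  have hT : ∀ c ∈ filW p K v s n, ∀ j, 0 ≤ v ((T c.out).coeff j) := by
    intro c hc j
    by_cases hj : j < s
    · have := mem_filW_iff.mp hc ⟨j, hj⟩
      rwa [coe_neg_le_smul_iff_nonneg hπ n (pow_pos hp.pos _) (pow_pos hp.pos j),
        ← TruncatedWittVector.coeff_out, ← hTc j hj c.out] at this
    · rw [WittVector.coeff_teichmuller_mul, WittVector.coeff_iterate_frobenius]
      simp [TruncatedWittVector.out, hj, hp.ne_zero]
  have h := WittVector.forall_pos_coeff_sub_iff (hT a ha) (hT b hb) s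
  have hab : ∀ i : Fin s, (a - b).coeff i = (a.out - b.out).coeff i := fun i => by
    rw [← WittVector.coeff_truncateFun, WittVector.truncateFun_sub,
      TruncatedWittVector.truncateFun_out, TruncatedWittVector.truncateFun_out]
  have hTab : T a.out - T b.out = T (a.out - b.out) := by
    simp only [T, WittVector.iterate_frobenius_sub, mul_sub]
  have : ExpChar K p := ExpChar.prime hp
  rw [mem_filW_iff]
  refine Iff.trans ?_ (h.trans ?_)
  · rw [hTab, Fin.forall_iff]
    refine forall₂_congr fun j hj => ?_
    rw [coe_neg_sub_one_le_smul_iff_pos hπ n (pow_pos hp.pos _) (pow_pos hp.pos j), hab,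
      ← hTc j hj]
  · rw [Fin.forall_iff]
    refine forall₂_congr fun j hj => ?_
    rw [coe_neg_sub_one_le_smul_iff_pos hπ n (pow_pos hp.pos _) (pow_pos hp.pos j),
      hTc j hj, hTc j hj, ← mul_sub, ← pow_add, sub_pow_expChar_pow,
      ← TruncatedWittVector.coeff_out a ⟨j, hj⟩, ← TruncatedWittVector.coeff_out b ⟨j, hj⟩]

end WittFiltration

section Forms

variable {p : ℕ} {K : Type*} [Field K] {v : AddValuation K (WithTop ℤ)} {π : K}

theorem smul_D_mem_filOmegaLog (hπ : v π = 1) {c x : K} {k m N : ℤ} (hc : (k : WithTop ℤ) ≤ v c)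
    (hx : (m : WithTop ℤ) ≤ v x) (hN : -N ≤ k + m) :
    c • KaehlerDifferential.D (Kp p K) K x ∈ filOmegaLog p K v π N := by
  have hπ0 := AddValuation.ne_zero_of_eq_one hπ
  have hu := (AddValuation.coe_le_map_iff hπ m x).mp hx
  set u := π ^ (-m) * x with hudef
  have hxu : x = π ^ m * u := by
    rw [hudef, ← mul_assoc, ← zpow_add₀ hπ0, add_neg_cancel, zpow_zero, one_mul]
  have hc' : 0 ≤ v (π ^ (m + N) * c) := by
    have := (AddValuation.coe_le_map_iff hπ (-(m + N)) c).mp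
      (le_trans (WithTop.coe_le_coe.mpr (by lia)) hc)
    rwa [neg_neg] at this
  have h_int : 0 ≤ v (m : K) := by
    have : (m : K) ∈ v.toValuation.valuationSubring := intCast_mem _ m
    exact this
  have hsplit : c • KaehlerDifferential.D (Kp p K) K x =
      (π ^ (m + N) * c * π ^ (-N)) • KaehlerDifferential.D (Kp p K) K u +
      (π ^ (m + N) * c * u * m * π ^ (-N - 1)) • KaehlerDifferential.D (Kp p K) K π := by
    rw [hxu, Derivation.leibniz, Derivation.leibniz_zpow, smul_add, smul_smul, smul_smul,
      ← Int.cast_smul_eq_zsmul K, smul_smul, smul_smul]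
    congr 2
    · rw [mul_right_comm, ← zpow_add₀ hπ0, add_neg_cancel_right, mul_comm]
    · have : π ^ (m + N) * π ^ (-N - 1) = π ^ (m - 1) := by
        rw [← zpow_add₀ hπ0]
        congr 1
        ring
      linear_combination -(c * u * m) * this
  rw [hsplit]
  refine add_mem (AddSubgroup.subset_closure ⟨_, u, hc', hu, Or.inr rfl⟩)
    (AddSubgroup.subset_closure ⟨_, u, ?_, hu, Or.inl rfl⟩)
  rw [AddValuation.map_mul, AddValuation.map_mul]
  exact add_nonneg (add_nonneg hc' hu) h_int

theorem sumForm_eq_sum_range {s : ℕ} {a : TruncatedWittVector p s K} {A : ℕ → K}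
    (hA : ∀ i : Fin s, a.coeff i = A (s - 1 - i)) :
    sumForm p K a = ∑ e ∈ Finset.range s,
      (A e ^ (p ^ e - 1)) • KaehlerDifferential.D (Kp p K) K (A e) := by
  rw [← Finset.sum_range_reflect, ← Fin.sum_univ_eq_sum_range
    (fun i => (A (s - 1 - i) ^ (p ^ (s - 1 - i) - 1)) •
      KaehlerDifferential.D (Kp p K) K (A (s - 1 - i)))]
  exact Finset.sum_congr rfl fun i _ => by rw [hA]

theorem D_sub_pow_char [CharP K p] (x y : K) : KaehlerDifferential.D (Kp p K) K (x - y ^ p) =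
    KaehlerDifferential.D (Kp p K) K x := by
  rw [map_sub, Derivation.leibniz_pow, ← Nat.cast_smul_eq_nsmul K, CharP.cast_eq_zero, zero_smul,
    sub_zero]

variable [Fact p.Prime]

theorem frobW_mem_filW_iff {s : ℕ} {n : ℤ} {x : TruncatedWittVector p s K} :
    frobW p K x ∈ filW p K v s n ↔ x ∈ filW p K v s (n / p) := by
  have hp : p.Prime := Fact.out
  rw [mem_filW_iff, mem_filW_iff]
  refine forall_congr' fun i => ?_
  rw [frobW, TruncatedWittVector.coeff_mk, AddValuation.map_pow, ← mul_nsmul', mul_comm,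
    coe_neg_le_smul_iff v n (mul_pos hp.pos (pow_pos hp.pos _)),
    coe_neg_le_smul_iff v _ (pow_pos hp.pos _), Nat.cast_mul, Int.ediv_ediv_of_nonneg (by simp)]

end Forms

/-- Lemma 1.7 of the paper.  Let `n ≥ 1`.
(a) If `x ∈ fil_{[n/p]} W_s(K)` and `F x ∈ fil_{n-1} W_s(K)` then
`x ∈ fil_{[(n-1)/p]} W_s(K)`, so `F` induces an injection
`fil_{[n/p]}/fil_{[(n-1)/p]} → fil_n/fil_{n-1}`.
(b) For `a = (a_{s-1}, …, a_0) ∈ fil_n W_s(K)` one has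
`∑ a_i^{p^i - 1} da_i ∈ fil_{n-1} Ω¹_K` iff `a ∈ fil_{n-1} W_s(K) + F(fil_{[n/p]} W_s(K))`.
Together these express the exactness of
`0 → fil_{[n/p]}/fil_{[(n-1)/p]} → fil_n/fil_{n-1} → fil_nΩ¹_K/fil_{n-1}Ω¹_K`. -/
theorem statement1 (s n : ℕ) (hn : 1 ≤ n) (π : K) (hπ : v π = 1) :
    (∀ x : TruncatedWittVector p s K,
        x ∈ filW p K v s ((n / p : ℕ) : ℤ) →
        frobW p K x ∈ filW p K v s ((n : ℤ) - 1) →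
        x ∈ filW p K v s (((n - 1) / p : ℕ) : ℤ)) ∧
    (∀ a ∈ filW p K v s (n : ℤ),
        (sumForm p K a ∈ filOmegaLog p K v π ((n : ℤ) - 1) ↔
          ∃ b ∈ filW p K v s ((n : ℤ) - 1),
            ∃ c ∈ filW p K v s ((n / p : ℕ) : ℤ), a = b + frobW p K c)) := by

  have hp : p.Prime := Fact.out
  have hcast : ((n / p : ℕ) : ℤ) = (n : ℤ) / p := Int.natCast_div n p
  have hcast' : (((n - 1) / p : ℕ) : ℤ) = ((n : ℤ) - 1) / p := by
    rw [Int.natCast_div, Nat.cast_sub hn, Nat.cast_one]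
  rw [hcast, hcast']
  refine ⟨fun x _ hx => frobW_mem_filW_iff.mp hx, fun a ha => ⟨fun hω => ?_, ?_⟩⟩
  · let A : ℕ → K := fun e => if h : s - 1 - e < s then a.coeff ⟨s - 1 - e, h⟩ else 0
    have hA : ∀ i : Fin s, a.coeff i = A (s - 1 - i) := fun i => by
      have h : s - 1 - (s - 1 - (i : ℕ)) = i := by lia
      simp [A, h]
    have hAv : ∀ e < s, ((-((n : ℤ) / (p ^ e : ℕ)) : ℤ) : WithTop ℤ) ≤ v (A e) := by
      intro e he
      have h : s - 1 - (s - 1 - e) = e := by lia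
      have h1 := mem_filW_iff.mp ha ⟨s - 1 - e, by lia⟩
      rw [coe_neg_le_smul_iff v _ (pow_pos hp.pos _), hA] at h1
      simpa only [h] using h1
    obtain ⟨F, _, _, Φ, hΦ₁, hΦ₂, hΦ₃, hΦ₄⟩ := exists_ringHom_laurentSeries (p := p) hπ
    rw [sumForm_eq_sum_range hA] at hω
    obtain ⟨C, hC⟩ := exists_sub_pow_of_sum_mem_filOmegaLog A ⟨hΦ₁, hΦ₂, hΦ₃, hΦ₄⟩ hπ s n hAv hω
    let c : TruncatedWittVector p s K := TruncatedWittVector.mk p fun i => C (s - 1 - i)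
    have hc : c ∈ filW p K v s ((n : ℤ) / p) := mem_filW_iff.mpr fun i => by
      rw [coe_neg_le_smul_iff v _ (pow_pos hp.pos _), Int.ediv_ediv_of_nonneg (by simp),
        ← Nat.cast_mul, ← pow_succ', TruncatedWittVector.coeff_mk]
      exact (hC (s - 1 - i) (by lia)).1
    refine ⟨a - frobW p K c, ?_, c, hc, (sub_add_cancel _ _).symm⟩
    rw [sub_mem_filW_sub_one_iff hπ ha (frobW_mem_filW_iff.mpr hc)]
    intro i
    rw [coe_neg_le_smul_iff v _ (pow_pos hp.pos _), frobW, TruncatedWittVector.coeff_mk,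
      TruncatedWittVector.coeff_mk, hA]
    exact (hC (s - 1 - i) (by lia)).2
  · rintro ⟨b, hb, c, hc, hab⟩
    have hsub := (sub_mem_filW_sub_one_iff hπ ha (frobW_mem_filW_iff.mpr hc)).mp
      (by rwa [hab, add_sub_cancel_right])
    refine sum_mem fun i _ => ?_
    have ha' := mem_filW_iff.mp ha i
    have hi := hsub i
    rw [frobW, TruncatedWittVector.coeff_mk] at hi
    have hq := pow_pos hp.pos (s - 1 - (i : ℕ))
    set q := p ^ (s - 1 - (i : ℕ))
    rw [coe_neg_le_smul_iff v _ hq] at ha' hi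
    rw [← D_sub_pow_char _ (c.coeff i)]
    have hpow := nsmul_le_nsmul_right ha' (q - 1)
    rw [← WithTop.coe_nsmul, ← AddValuation.map_pow, nsmul_eq_mul] at hpow
    refine smul_D_mem_filOmegaLog hπ hpow hi ?_
    have hq' : (0 : ℤ) < q := by exact_mod_cast hq
    have h1 := Int.ediv_mul_le (n : ℤ) hq'.ne'
    have h2 := Int.ediv_mul_le ((n : ℤ) - 1) hq'.ne'
    have h3 := Int.ediv_le_ediv hq' (sub_le_self (n : ℤ) zero_le_one)
    rw [Nat.cast_sub hq, Nat.cast_one]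
    rcases h3.lt_or_eq with h3 | h3
    · linarith
    · rw [h3] at h2 ⊢
      linarith
end
end

section
/- Let m ≥ 1 and 0 ≤ t ≤ s be integers. Then: (i) pr_t(fil'_m W_s(K)) = fil'^{(s-t)}_m W_t(K) and pr_t(fil''_m W_s(K)) = fil''^{(s-t)}_m W_t(K); (ii) the sequences 0 → fil'_m W_{s-t}(K) → fil'_m W_s(K) → fil'^{(s-t)}_m W_t(K) → 0 and 0 → fil''_m W_{s-t}(K) → fil''_m W_s(K) → fil''^{(s-t)}_m W_t(K) → 0, with first maps the t-fold Verschiebung V^t and second maps the truncation pr_t, are exact. -/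
/-!
Setting: `K` is a (complete) discrete valuation field of characteristic `p > 0`, with
normalized additive valuation `v = ord_K : K → ℤ ∪ {∞}` (normalization is expressed by
the existence of a uniformizer `π` with `v π = 1`).

`W_s(K)` is the ring of `p`-typical Witt vectors of length `s` over `K`.  Following the
paper, a Witt vector is written `a = (a_{s-1}, …, a_0)`, where the paper's component
`a_i` is the component of standard index `s - 1 - i` (so `a_{s-1}` is the leading
component and the Verschiebung `V` sends `(a_{s-1}, …, a_0)` to `(0, a_{s-1}, …, a_0)`,
i.e. it is the standard index shift).  We realize `W_s(K)` as `TruncatedWittVector p s K`.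
-/

noncomputable section

open TruncatedWittVector

variable (p : ℕ) [Fact p.Prime] (K : Type*) [Field K] [CharP K p]
variable (v : AddValuation K (WithTop ℤ))

namespace WittVector

open MvPolynomial

/-- The addition polynomials of Witt vectors are homogeneous of degree `p ^ n` when the `i`-th
components have weight `p ^ i`. -/
theorem isWeightedHomogeneous_wittAdd (q : ℕ) [hq : Fact q.Prime] (n : ℕ) :
    IsWeightedHomogeneous (fun j : Fin 2 × ℕ => q ^ j.2) (wittAdd q n) (q ^ n) := by
  induction n using Nat.strong_induction_on with
  | _ n ih =>
  have key := wittStructureInt_prop q (X 0 + X 1 : MvPolynomial (Fin 2) ℤ) n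
  change bind₁ (wittAdd q) _ = _ at key
  rw [bind₁, aeval_wittPolynomial, Finset.sum_range_succ, ← eq_sub_iff_add_eq'] at key
  have hpow : ∀ i ≤ n, q ^ (n - i) • q ^ i = q ^ n := fun i hi => by
    rw [smul_eq_mul, ← pow_add, Nat.sub_add_cancel hi]
  have hcast : ∀ i : ℕ, (q : MvPolynomial (Fin 2 × ℕ) ℤ) ^ i = C ((q : ℤ) ^ i) := by simp
  have hghost : ∀ b : Fin 2, IsWeightedHomogeneous (fun j : Fin 2 × ℕ => q ^ j.2)
      (rename (Prod.mk b) (wittPolynomial q ℤ n)) (q ^ n) := fun b => by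
    rw [wittPolynomial_eq_sum_C_mul_X_pow, map_sum]
    refine IsWeightedHomogeneous.sum _ _ _ fun i hi => ?_
    rw [map_mul, rename_C, map_pow (rename _), rename_X]
    refine IsWeightedHomogeneous.C_mul ?_ _
    rw [← hpow i (by simpa [Nat.lt_succ_iff] using hi)]
    exact (isWeightedHomogeneous_X ℤ (fun j : Fin 2 × ℕ => q ^ j.2) (b, i)).pow _
  have hmul : IsWeightedHomogeneous (fun j : Fin 2 × ℕ => q ^ j.2)
      (C ((q : ℤ) ^ n) * wittAdd q n) (q ^ n) := by
    rw [Nat.sub_self, pow_zero, pow_one, hcast] at key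
    rw [key]
    refine IsWeightedHomogeneous.sub ?_ (IsWeightedHomogeneous.sum _ _ _ fun i hi => ?_)
    · simpa using (hghost 0).add (hghost 1)
    · have hi : i < n := by simpa using hi
      rw [hcast, ← hpow i hi.le]
      exact ((ih i hi).pow _).C_mul _
  intro d hd
  refine hmul ?_
  rw [coeff_C_mul]
  exact mul_ne_zero (pow_ne_zero _ (by exact_mod_cast hq.out.ne_zero)) hd

end WittVector

section Valuation

variable {F : Type*} [Field F] (w : AddValuation F (WithTop ℤ))

theorem AddValuation.zero_le_map_intCast (z : ℤ) : 0 ≤ w (z : F) := by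
  have hnat : ∀ n : ℕ, 0 ≤ w (n : F) := fun n => by
    induction n with
    | zero => simp
    | succ n ih => rw [Nat.cast_succ]; exact w.map_le_add ih w.map_one.ge
  obtain ⟨n, rfl | rfl⟩ := z.eq_nat_or_neg
  · simpa using hnat n
  · simpa using hnat n

theorem AddValuation.le_nsmul_map_sum {ι : Type*} {S : Finset ι} {f : ι → F} {M : ℕ} (hM : 0 < M)
    {g : WithTop ℤ} (hf : ∀ i ∈ S, g ≤ M • w (f i)) : g ≤ M • w (∑ i ∈ S, f i) := by
  classical
  induction S using Finset.induction_on with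
  | empty =>
    obtain ⟨k, rfl⟩ := Nat.exists_eq_succ_of_ne_zero hM.ne'
    simp [succ_nsmul]
  | insert a S ha ih =>
    rw [Finset.sum_insert ha]
    obtain h | h := w.map_add' (f a) (∑ i ∈ S, f i)
    · exact (hf a (Finset.mem_insert_self a S)).trans (nsmul_le_nsmul_right h M)
    · exact (ih fun i hi => hf i (Finset.mem_insert_of_mem hi)).trans (nsmul_le_nsmul_right h M)

/-- If `M * w (x j) ≥ -n * wt j` for all variables `x j` of weight at most `k`, then the value at
`x` of a weighted homogeneous integral polynomial of degree `k` satisfies the same bound. -/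
theorem AddValuation.le_nsmul_map_aeval {σ : Type*} {wt : σ → ℕ} {φ : MvPolynomial σ ℤ} {k : ℕ}
    (hφ : MvPolynomial.IsWeightedHomogeneous wt φ k) {n : ℤ} {M : ℕ} (hM : 0 < M)
    {x : σ → F}
    (hx : ∀ j, wt j ≤ k → ((-(n * wt j) : ℤ) : WithTop ℤ) ≤ M • w (x j)) :
    ((-(n * k) : ℤ) : WithTop ℤ) ≤ M • w (MvPolynomial.aeval x φ) := by
  have hprod : ∀ d : σ →₀ ℕ, (∀ j ∈ d.support, wt j ≤ k) →
      ((-(n * (Finsupp.weight wt d : ℕ)) : ℤ) : WithTop ℤ) ≤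
        M • w (d.prod fun j e => x j ^ e) := by
    intro d hd
    have hmap : ∀ S : Finset σ, w (∏ j ∈ S, x j ^ d j) = ∑ j ∈ S, d j • w (x j) := by
      classical
      intro S
      induction S using Finset.induction_on with
      | empty => simp
      | insert a S ha ih => rw [Finset.prod_insert ha, Finset.sum_insert ha, w.map_mul, ih, w.map_pow]
    rw [Finsupp.prod, hmap, Finset.smul_sum, Finsupp.weight_apply, Finsupp.sum]
    have hcast : ((-(n * ((∑ j ∈ d.support, d j • wt j : ℕ) : ℤ)) : ℤ) : WithTop ℤ) =
        ∑ j ∈ d.support, d j • ((-(n * wt j) : ℤ) : WithTop ℤ) := by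
      have : (-(n * ((∑ j ∈ d.support, d j • wt j : ℕ) : ℤ)) : ℤ) =
          ∑ j ∈ d.support, d j • (-(n * wt j) : ℤ) := by
        push_cast
        rw [Finset.mul_sum, ← Finset.sum_neg_distrib]
        refine Finset.sum_congr rfl fun j _ => ?_
        simp only [smul_eq_mul, nsmul_eq_mul, Nat.cast_mul]
        ring
      rw [this, WithTop.coe_sum]
      exact Finset.sum_congr rfl fun j _ => WithTop.coe_nsmul _ _
    rw [hcast]
    refine Finset.sum_le_sum fun j hj => ?_
    rw [smul_comm M]
    exact nsmul_le_nsmul_right (hx j (hd j hj)) _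
  rw [MvPolynomial.aeval_def, MvPolynomial.eval₂_eq]
  refine w.le_nsmul_map_sum hM fun d hd => ?_
  have hwt := hφ (MvPolynomial.mem_support_iff.mp hd)
  have hle : ∀ j ∈ d.support, wt j ≤ k := fun j hj =>
    hwt ▸ Finsupp.le_weight_of_ne_zero' wt (Finsupp.mem_support_iff.mp hj)
  have hd' := hprod d hle
  rw [hwt] at hd'
  rw [w.map_mul, nsmul_add]
  refine hd'.trans (le_add_of_nonneg_left (nsmul_nonneg ?_ M))
  simpa using w.zero_le_map_intCast (φ.coeff d)

end Valuation

theorem WithTop.neg_coe_ediv_le_nsmul_iff {P q : ℕ} (hP : 0 < P) (hq : 0 < q) (n : ℤ)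
    (x : WithTop ℤ) :
    ((-(n / P) : ℤ) : WithTop ℤ) ≤ q • x ↔ ((-n : ℤ) : WithTop ℤ) ≤ (q * P) • x := by
  induction x using WithTop.recTopCoe with
  | top =>
    obtain ⟨k, rfl⟩ := Nat.exists_eq_succ_of_ne_zero hq.ne'
    obtain ⟨l, hl⟩ := Nat.exists_eq_succ_of_ne_zero (Nat.mul_pos hq hP).ne'
    simp [hl, succ_nsmul]
  | coe x =>
    have hP' : (0 : ℤ) < P := by exact_mod_cast hP
    rw [← WithTop.coe_nsmul, ← WithTop.coe_nsmul, WithTop.coe_le_coe, WithTop.coe_le_coe,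
      neg_le, Int.le_ediv_iff_mul_le hP', neg_mul, neg_le, mul_comm q, mul_nsmul',
      nsmul_eq_mul P, mul_comm (P : ℤ)]

namespace TruncatedWittVector

variable {q : ℕ} {F : Type*}

theorem coeff_prW {s t : ℕ} (ht : t ≤ s) (a : TruncatedWittVector q s F) (i : Fin t) :
    (prW q F t ht a).coeff i = a.coeff (Fin.castLE ht i) :=
  rfl

variable [Field F]

/-- A componentwise description of the sum of `fil_{n₁} W_s(F)` and the image of
`fil_{n₂} W_d(F)`: the last `d` components satisfy the bound for `n₂`, the other ones that
for `n₁`. -/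
def mixedFil (w : AddValuation F (WithTop ℤ)) (s d : ℕ) (n₁ n₂ : ℤ) :
    Set (TruncatedWittVector q s F) :=
  {a | ∀ i : Fin s, ((-(if (i : ℕ) < s - d then n₁ else n₂) : ℤ) : WithTop ℤ) ≤
    q ^ (s - 1 - (i : ℕ)) • w (a.coeff i)}

variable {w : AddValuation F (WithTop ℤ)}

theorem mem_filW_iff {s : ℕ} {n : ℤ} {a : TruncatedWittVector q s F} :
    a ∈ filW q F w s n ↔
      ∀ i : Fin s, ((-n : ℤ) : WithTop ℤ) ≤ q ^ (s - 1 - (i : ℕ)) • w (a.coeff i) := by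
  simp [filW, wittOrd, Finset.le_inf_iff]

theorem coeff_VShift {k t s : ℕ} (a : TruncatedWittVector q t F) (i : Fin s) :
    (VShift q F k s a).coeff i =
      if h : k ≤ (i : ℕ) ∧ (i : ℕ) - k < t then a.coeff ⟨(i : ℕ) - k, h.2⟩ else 0 :=
  rfl

theorem VShift_injective {s t : ℕ} :
    Function.Injective (VShift q F t s : TruncatedWittVector q (s - t) F → _) := by
  intro x y h
  ext i
  have := congrArg (coeff ⟨t + i, by omega⟩) h
  simpa [coeff_VShift] using this

variable [Fact q.Prime]

theorem coeff_add_eq_coeff_out_add_out {s : ℕ} (a b : TruncatedWittVector q s F) (k : Fin s) :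
    (a + b).coeff k = (a.out + b.out).coeff k :=
  WittVector.coeff_truncateFun _ _

theorem le_map_coeff_add {s : ℕ} {a b : TruncatedWittVector q s F} {n : ℤ} {k : Fin s}
    (ha : ∀ i ≤ k, ((-n : ℤ) : WithTop ℤ) ≤ q ^ (s - 1 - (i : ℕ)) • w (a.coeff i))
    (hb : ∀ i ≤ k, ((-n : ℤ) : WithTop ℤ) ≤ q ^ (s - 1 - (i : ℕ)) • w (b.coeff i)) :
    ((-n : ℤ) : WithTop ℤ) ≤ q ^ (s - 1 - (k : ℕ)) • w ((a + b).coeff k) := by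
  have hp := (Fact.out : q.Prime)
  have hscale : ∀ (i : Fin s) (x : WithTop ℤ),
      ((-n : ℤ) : WithTop ℤ) ≤ q ^ (s - 1 - (i : ℕ)) • x ↔
        ((-(n * (q ^ (i : ℕ) : ℕ)) : ℤ) : WithTop ℤ) ≤ q ^ (s - 1) • x := fun i x => by
    have hi : q ^ (s - 1 - (i : ℕ)) * q ^ (i : ℕ) = q ^ (s - 1) := by
      rw [← pow_add, Nat.sub_add_cancel (by omega)]
    rw [← hi, ← WithTop.neg_coe_ediv_le_nsmul_iff (pow_pos hp.pos _) (pow_pos hp.pos _),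
      Int.mul_ediv_cancel _ (by exact_mod_cast (pow_pos hp.pos _).ne')]
  rw [coeff_add_eq_coeff_out_add_out, WittVector.add_coeff, WittVector.peval, hscale]
  refine w.le_nsmul_map_aeval (WittVector.isWeightedHomogeneous_wittAdd q k) (pow_pos hp.pos _) ?_
  rintro ⟨j, i⟩ hi
  have hik : i ≤ k := (Nat.pow_le_pow_iff_right hp.one_lt).mp hi
  have his : i < s := hik.trans_lt k.2
  have hval : ∀ c : TruncatedWittVector q s F, c.out.coeff i = c.coeff ⟨i, his⟩ :=
    fun c => c.coeff_out ⟨i, his⟩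
  fin_cases j
  · simpa [Function.uncurry, hval] using (hscale ⟨i, his⟩ _).mp (ha ⟨i, his⟩ hik)
  · simpa [Function.uncurry, hval] using (hscale ⟨i, his⟩ _).mp (hb ⟨i, his⟩ hik)

theorem coeff_add_of_disjoint {s : ℕ} {a b : TruncatedWittVector q s F}
    (h : ∀ i, a.coeff i = 0 ∨ b.coeff i = 0) (k : Fin s) :
    (a + b).coeff k = a.coeff k + b.coeff k := by
  rw [coeff_add_eq_coeff_out_add_out, WittVector.coeff_add_of_disjoint, coeff_out, coeff_out]
  intro i
  by_cases hi : i < s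
  · simpa [out, hi] using h ⟨i, hi⟩
  · simp [out, hi]

theorem le_pow_nsmul_map_zero (n : ℤ) (k : ℕ) : ((-n : ℤ) : WithTop ℤ) ≤ q ^ k • w 0 := by
  obtain ⟨l, hl⟩ := Nat.exists_eq_succ_of_ne_zero
    (pow_ne_zero k (Fact.out : q.Prime).ne_zero)
  simp [hl, succ_nsmul]

theorem mem_mixedFil_iff {s d : ℕ} (hd : d ≤ s) {n₁ n₂ : ℤ} (hn : n₁ ≤ n₂)
    {a : TruncatedWittVector q s F} :
    a ∈ mixedFil w s d n₁ n₂ ↔ ∃ b ∈ filW q F w s n₁, ∃ c ∈ filW q F w d n₂,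
      a = b + VShift q F (s - d) s c := by
  constructor
  · intro ha
    refine ⟨mk q fun i => if (i : ℕ) < s - d then a.coeff i else 0, ?_,
      mk q fun i => a.coeff ⟨s - d + i, by omega⟩, ?_, ?_⟩
    · refine mem_filW_iff.mpr fun i => ?_
      rw [coeff_mk]
      split_ifs with hi
      · simpa [hi] using ha i
      · exact le_pow_nsmul_map_zero _ _
    · refine mem_filW_iff.mpr fun i => ?_
      have := ha ⟨s - d + i, by omega⟩
      rw [if_neg (by simp)] at this
      rw [coeff_mk]
      convert this using 3
      simp only
      omega
    · ext i
      rw [coeff_add_of_disjoint, coeff_VShift, coeff_mk]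
      · by_cases hi : (i : ℕ) < s - d
        · simp [hi, not_le.mpr hi]
        · rw [if_neg hi, dif_pos (by omega), coeff_mk, zero_add]
          congr 1
          ext
          simp only
          omega
      · intro i
        rw [coeff_VShift, coeff_mk]
        by_cases hi : (i : ℕ) < s - d
        · exact Or.inr (dif_neg (by omega))
        · exact Or.inl (if_neg hi)
  · rintro ⟨b, hb, c, hc, rfl⟩ i
    rw [mem_filW_iff] at hb hc
    split_ifs with hi
    · refine le_map_coeff_add (fun j _ => hb j) fun j hj => ?_
      have hj : (j : ℕ) ≤ i := hj
      rw [coeff_VShift, dif_neg (by omega)]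
      exact le_pow_nsmul_map_zero _ _
    · refine le_map_coeff_add (fun j _ => le_trans ?_ (hb j)) fun j _ => ?_
      · exact WithTop.coe_le_coe.mpr (neg_le_neg hn)
      · rw [coeff_VShift]
        split_ifs with hj
        · convert hc ⟨j - (s - d), hj.2⟩ using 3
          simp only
          omega
        · exact le_pow_nsmul_map_zero _ _

theorem filW'_eq_mixedFil (s m : ℕ) :
    filW' q F w s m = mixedFil w s (min (padicValNat q m) s) ((m : ℤ) - 1) m :=
  Set.ext fun _ => (mem_mixedFil_iff (min_le_right _ _) (by omega)).symm

theorem filW'r_eq_mixedFil (s r m : ℕ) :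
    filW'r q F w s r m = mixedFil w s (min (padicValNat q m) (s + r) - r)
      (((m - 1) / q ^ r : ℕ) : ℤ) ((m / q ^ r : ℕ) : ℤ) :=
  Set.ext fun _ => (mem_mixedFil_iff (by omega) (by
    exact_mod_cast Nat.div_le_div_right (Nat.sub_le m 1))).symm

theorem filW''r_eq_mixedFil (s r m : ℕ) :
    filW''r q F w s r m = mixedFil w s (min (padicValNat q m) (s + r) - r)
      (((m - 1) / q / q ^ r : ℕ) : ℤ) ((m / q / q ^ r : ℕ) : ℤ) :=
  Set.ext fun _ => (mem_mixedFil_iff (by omega) (by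
    exact_mod_cast Nat.div_le_div_right (Nat.div_le_div_right (Nat.sub_le m 1)))).symm

theorem filW''_eq_mixedFil (s m : ℕ) :
    filW'' q F w s m = mixedFil w s (min (padicValNat q m) s)
      (((m - 1) / q : ℕ) : ℤ) ((m / q : ℕ) : ℤ) := by
  rw [filW'', filW''r_eq_mixedFil]
  simp

theorem image_prW_mixedFil {s t d : ℕ} (ht : t ≤ s) (hd : d ≤ s) (n₁ n₂ : ℤ) :
    prW q F t ht '' mixedFil w s d n₁ n₂ =
      mixedFil w t (d - (s - t)) (n₁ / (q ^ (s - t) : ℕ)) (n₂ / (q ^ (s - t) : ℕ)) := by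
  have hbound : ∀ (i : Fin t) (x : WithTop ℤ),
      ((-(if (i : ℕ) < t - (d - (s - t)) then n₁ / (q ^ (s - t) : ℕ)
        else n₂ / (q ^ (s - t) : ℕ)) : ℤ) : WithTop ℤ) ≤ q ^ (t - 1 - (i : ℕ)) • x ↔
      ((-(if (i : ℕ) < s - d then n₁ else n₂) : ℤ) : WithTop ℤ) ≤
        q ^ (s - 1 - (i : ℕ)) • x := fun i x => by
    have hi : (i : ℕ) < t - (d - (s - t)) ↔ (i : ℕ) < s - d := by omega
    have he : s - 1 - (i : ℕ) = t - 1 - i + (s - t) := by omega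
    rw [← apply_ite (· / ((q ^ (s - t) : ℕ) : ℤ)),
      WithTop.neg_coe_ediv_le_nsmul_iff (pow_pos (Fact.out : q.Prime).pos _)
        (pow_pos (Fact.out : q.Prime).pos _), ← pow_add, he]
    simp only [hi]
  ext y
  constructor
  · rintro ⟨a, ha, rfl⟩ i
    exact (hbound i _).mpr (ha (Fin.castLE ht i))
  · intro hy
    refine ⟨mk q fun i => if h : (i : ℕ) < t then y.coeff ⟨i, h⟩ else 0, fun i => ?_, ?_⟩
    · rw [coeff_mk]
      by_cases hi : (i : ℕ) < t
      · rw [dif_pos hi]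
        exact (hbound ⟨i, hi⟩ _).mp (hy ⟨i, hi⟩)
      · rw [dif_neg hi]
        exact le_pow_nsmul_map_zero _ _
    · ext i
      simp [coeff_prW]

theorem VShift_mem_mixedFil_iff {s t e : ℕ} (ht : t ≤ s) {n₁ n₂ : ℤ}
    {x : TruncatedWittVector q (s - t) F} :
    VShift q F t s x ∈ mixedFil w s (min e s) n₁ n₂ ↔
      x ∈ mixedFil w (s - t) (min e (s - t)) n₁ n₂ := by
  constructor
  · intro h i
    have := h ⟨t + i, by omega⟩
    rw [coeff_VShift, dif_pos (by simp)] at this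
    convert this using 3
    · have : (i : ℕ) < s - t - min e (s - t) ↔ t + (i : ℕ) < s - min e s := by omega
      simp only [this]
    · simp only
      omega
    · simp
  · intro h i
    rw [coeff_VShift]
    by_cases hi : t ≤ (i : ℕ)
    · have hi' : (i : ℕ) - t < s - t := by omega
      rw [dif_pos ⟨hi, hi'⟩]
      convert h ⟨i - t, hi'⟩ using 3
      · have : (i : ℕ) < s - min e s ↔ (i : ℕ) - t < s - t - min e (s - t) := by omega
        simp only [this]
      · simp only
        omega
    · rw [dif_neg (by omega)]
      exact le_pow_nsmul_map_zero _ _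

theorem prW_eq_zero_iff {s t : ℕ} (ht : t ≤ s) {y : TruncatedWittVector q s F} :
    prW q F t ht y = 0 ↔ ∃ x : TruncatedWittVector q (s - t) F, VShift q F t s x = y := by
  constructor
  · intro h
    refine ⟨mk q fun i => y.coeff ⟨t + i, by omega⟩, ?_⟩
    ext i
    rw [coeff_VShift]
    split_ifs with hi
    · rw [coeff_mk]
      congr 1
      ext
      simp only
      omega
    · have := congrArg (coeff ⟨i, by omega⟩) h
      simpa [coeff_prW] using this.symm
  · rintro ⟨x, rfl⟩
    ext i
    rw [coeff_prW, coeff_VShift, dif_neg (by simp), coeff_zero]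

end TruncatedWittVector

/-- Lemma 1.18 (i)--(iv) of the paper.  Let `m ≥ 1` and `0 ≤ t ≤ s`.
(i) `pr_t(fil'_m W_s(K)) = fil'^{(s-t)}_m W_t(K)` and
`pr_t(fil''_m W_s(K)) = fil''^{(s-t)}_m W_t(K)`;
(ii) the sequences `0 → fil'_m W_{s-t} → fil'_m W_s → fil'^{(s-t)}_m W_t → 0` and
`0 → fil''_m W_{s-t} → fil''_m W_s → fil''^{(s-t)}_m W_t → 0` (first maps `V^t`,
second maps `pr_t`) are exact. -/
theorem statement7 (hv : ∃ π : K, v π = 1) (s t m : ℕ) (ht : t ≤ s) (hm : 1 ≤ m) :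
    (prW p K t ht '' (filW' p K v s m) = filW'r p K v t (s - t) m) ∧
    (prW p K t ht '' (filW'' p K v s m) = filW''r p K v t (s - t) m) ∧
    (∀ x ∈ filW' p K v (s - t) m, VShift p K t s x ∈ filW' p K v s m) ∧
    (Set.InjOn (VShift p K t s) (filW' p K v (s - t) m)) ∧
    (∀ y ∈ filW' p K v s m,
        (prW p K t ht y = 0 ↔ ∃ x ∈ filW' p K v (s - t) m, VShift p K t s x = y)) ∧
    (∀ x ∈ filW'' p K v (s - t) m, VShift p K t s x ∈ filW'' p K v s m) ∧
    (Set.InjOn (VShift p K t s) (filW'' p K v (s - t) m)) ∧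
    (∀ y ∈ filW'' p K v s m,
        (prW p K t ht y = 0 ↔ ∃ x ∈ filW'' p K v (s - t) m, VShift p K t s x = y)) := by
  have hexact : ∀ n₁ n₂ : ℤ, ∀ y ∈ TruncatedWittVector.mixedFil v s (min (padicValNat p m) s) n₁ n₂,
      (prW p K t ht y = 0 ↔
        ∃ x ∈ TruncatedWittVector.mixedFil v (s - t) (min (padicValNat p m) (s - t)) n₁ n₂,
          VShift p K t s x = y) := fun n₁ n₂ y hy => by
    rw [TruncatedWittVector.prW_eq_zero_iff]
    constructor
    · rintro ⟨x, rfl⟩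
      exact ⟨x, (TruncatedWittVector.VShift_mem_mixedFil_iff ht).mp hy, rfl⟩
    · rintro ⟨x, -, hx⟩
      exact ⟨x, hx⟩
  simp only [TruncatedWittVector.filW'_eq_mixedFil, TruncatedWittVector.filW''_eq_mixedFil,
    TruncatedWittVector.filW'r_eq_mixedFil, TruncatedWittVector.filW''r_eq_mixedFil,
    Nat.add_sub_cancel' ht]
  refine ⟨?_, ?_, fun x hx => (TruncatedWittVector.VShift_mem_mixedFil_iff ht).mpr hx,
    TruncatedWittVector.VShift_injective.injOn, hexact _ _,
    fun x hx => (TruncatedWittVector.VShift_mem_mixedFil_iff ht).mpr hx,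
    TruncatedWittVector.VShift_injective.injOn, hexact _ _⟩
  · rw [TruncatedWittVector.image_prW_mixedFil ht (min_le_right _ _), Int.natCast_div,
      Int.natCast_div, Nat.cast_sub hm, Nat.cast_one]
  · rw [TruncatedWittVector.image_prW_mixedFil ht (min_le_right _ _), ← Int.natCast_div,
      ← Int.natCast_div]
end
end
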